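/- Let F be a totally real number field of degree n and K/F a CM extension. Assume that ζ_K(1/2) ≤ ρ_F/(4·[O_K^×:O_F^×]·h_F) · log(√D_K/D_F). Then h_K ≥ Ψ_F^{−1} · D_K^{1/4} · log(√D_K/D_F). -/

import Mathlib

open NumberField Filter Topology
open scoped NumberField ComplexOrder nonZeroDivisors

/-- The Dedekind zeta Dirichlet series of a number field, as a function of a real variable
(convergent for `1 < s`). -/
noncomputable def zetaSeries (L : Type) [Field L] [NumberField L] (s : ℝ) : ℝ :=
  ∑' I : (Ideal (𝓞 L))⁰, (Ideal.absNorm (I : Ideal (𝓞 L)) : ℝ) ^ (-s)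

/-- The Dedekind zeta Dirichlet series, complex variable version. -/
noncomputable def zetaSeriesC (L : Type) [Field L] [NumberField L] (s : ℂ) : ℂ :=
  ∑' I : (Ideal (𝓞 L))⁰, (Ideal.absNorm (I : Ideal (𝓞 L)) : ℂ) ^ (-s)

/-- The index `[𝓞_K^× : 𝓞_F^×]` of the unit group of `F` inside the unit group of `K`. -/
noncomputable def unitIndex (F K : Type) [Field F] [NumberField F] [Field K] [NumberField K]
    [Algebra F K] : ℕ :=
  (MonoidHom.range (Units.map (algebraMap (𝓞 F) (𝓞 K)).toMonoidHom)).index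

open MeasureTheory

section cube
variable {ι : Type*} [Fintype ι]

/-- The half-open unit cube. -/
def unitCube (ι : Type*) : Set (ι → ℝ) := Set.univ.pi fun _ => Set.Ioc 0 1

lemma measurableSet_unitCube : MeasurableSet (unitCube ι) :=
  MeasurableSet.univ_pi fun _ => measurableSet_Ioc

lemma volume_unitCube : volume (unitCube ι) = 1 := by
  simp [unitCube, volume_pi_pi]

/-- The integer vector `k` as a real vector. -/
def intVec (k : ι → ℤ) : ι → ℝ := fun i => k i

omit [Fintype ι] in
lemma iUnion_unitCube_translates :
    ⋃ k : ι → ℤ, (fun x => x + intVec k) '' unitCube ι = Set.univ := by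
  refine Set.eq_univ_of_forall fun x => Set.mem_iUnion.2
    ⟨fun i => ⌈x i⌉ - 1, fun i => x i - (⌈x i⌉ - 1), ?_, ?_⟩
  · intro i _
    have h1 := Int.ceil_lt_add_one (x i)
    have h2 := Int.le_ceil (x i)
    constructor <;> simp only <;> linarith
  · ext i
    simp [intVec]

omit [Fintype ι] in
lemma pairwise_disjoint_unitCube_translates :
    Pairwise (Function.onFun Disjoint
      fun k : ι → ℤ => (fun x => x + intVec k) '' unitCube ι) := by
  intro k l hkl
  refine Set.disjoint_left.2 ?_
  rintro _ ⟨x, hx, rfl⟩ ⟨y, hy, hxy⟩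
  apply hkl
  ext i
  have h := congrFun hxy i
  simp only [intVec, Pi.add_apply] at h
  have hxi := hx i trivial
  have hyi := hy i trivial
  simp only [Set.mem_Ioc] at hxi hyi
  have h1 : (k i : ℝ) < l i + 1 := by linarith [hxi.1, hyi.2]
  have h2 : (l i : ℝ) < k i + 1 := by linarith [hxi.2, hyi.1]
  have h1' : k i < l i + 1 := by exact_mod_cast h1
  have h2' : l i < k i + 1 := by exact_mod_cast h2
  omega

lemma measurableSet_unitCube_translate (k : ι → ℤ) :
    MeasurableSet ((fun x => x + intVec k) '' unitCube ι) :=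
  (MeasurableEquiv.addRight (intVec k)).measurableEmbedding.measurableSet_image.2
    measurableSet_unitCube

lemma tsum_lintegral_unitCube_add (φ : (ι → ℝ) → ENNReal) :
    ∑' k : ι → ℤ, ∫⁻ x in unitCube ι, φ (x + intVec k) = ∫⁻ x, φ x := by
  rw [← setLIntegral_univ φ, ← iUnion_unitCube_translates,
    lintegral_iUnion measurableSet_unitCube_translate pairwise_disjoint_unitCube_translates]
  congr 1; ext k
  exact ((measurePreserving_add_right volume (intVec k)).setLIntegral_comp_emb
    (MeasurableEquiv.addRight (intVec k)).measurableEmbedding _ _).symm ▸ rfl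

lemma hasSum_integral_unitCube_add {φ : (ι → ℝ) → ℂ} (hφ : Integrable φ) :
    HasSum (fun k : ι → ℤ => ∫ x in unitCube ι, φ (x + intVec k)) (∫ x, φ x) := by
  rw [← setIntegral_univ, ← iUnion_unitCube_translates]
  have h := hasSum_integral_iUnion measurableSet_unitCube_translate
    pairwise_disjoint_unitCube_translates (f := φ) (μ := volume) hφ.integrableOn
  have he : ∀ k : ι → ℤ, MeasurableEmbedding fun x : ι → ℝ => x + intVec k :=
    fun k => (MeasurableEquiv.addRight (intVec k)).measurableEmbedding
  have heq : ∀ k : ι → ℤ, ∫ x in (fun x => x + intVec k) '' unitCube ι, φ x =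
      ∫ x in unitCube ι, φ (x + intVec k) := fun k =>
    (measurePreserving_add_right volume (intVec k)).setIntegral_image_emb (he k) _ _
  simpa only [heq] using h

end cube

section poisson
variable {ι : Type*} [Fintype ι]

/-- The additive character `x ↦ exp(2πi k·x)` of `ℝ^ι`. -/
noncomputable def intChar (k : ι → ℤ) (x : ι → ℝ) : ℂ :=
  UnitAddTorus.mFourier k fun i => (x i : UnitAddCircle)

omit [Fintype ι] in
lemma continuous_toTorus : Continuous fun (x : ι → ℝ) (i : ι) => (x i : UnitAddCircle) :=
  continuous_pi fun i => (AddCircle.continuous_mk' 1).comp (continuous_apply i)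

lemma continuous_intChar (k : ι → ℤ) : Continuous (intChar k) :=
  (UnitAddTorus.mFourier k).continuous.comp continuous_toTorus

lemma norm_intChar (k : ι → ℤ) (x : ι → ℝ) : ‖intChar k x‖ = 1 := by
  simp only [intChar, UnitAddTorus.mFourier, ContinuousMap.coe_mk, fourier_apply, norm_prod,
    Circle.norm_coe, Finset.prod_const_one]

omit [Fintype ι] in
lemma toTorus_add_intVec (x : ι → ℝ) (k : ι → ℤ) :
    (fun i => (((x + intVec k) i : ℝ) : UnitAddCircle)) = fun i => (x i : UnitAddCircle) := by
  ext i
  simp only [Pi.add_apply, intVec, AddCircle.coe_add]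
  have : ((k i : ℝ) : UnitAddCircle) = 0 := by
    rw [AddCircle.coe_eq_zero_iff]
    exact ⟨k i, by simp⟩
  rw [this, add_zero]

lemma intChar_add_intVec (k l : ι → ℤ) (x : ι → ℝ) :
    intChar k (x + intVec l) = intChar k x := by
  unfold intChar
  rw [toTorus_add_intVec]

lemma intChar_eq (k : ι → ℤ) (x : ι → ℝ) :
    intChar k x = Complex.exp (2 * Real.pi * Complex.I * ∑ i, (k i : ℂ) * x i) := by
  simp only [intChar, UnitAddTorus.mFourier, ContinuousMap.coe_mk, fourier_coe_apply,
    Finset.mul_sum, Complex.exp_sum]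
  congr 1; ext i
  congr 1
  push_cast
  ring

/-- Poisson summation for the standard lattice. -/
theorem tsum_intVec_eq_tsum_integral_intChar {g : (ι → ℝ) → ℂ} (hg : Continuous g)
    (hbound : ∀ R : ℝ, ∃ u : (ι → ℤ) → ℝ, Summable u ∧
      ∀ x k, ‖x‖ ≤ R → ‖g (x + intVec k)‖ ≤ u k)
    (hsum : Summable fun k => ∫ x, intChar (-k) x * g x) :
    ∑' k : ι → ℤ, g (intVec k) = ∑' k : ι → ℤ, ∫ x, intChar (-k) x * g x := by
  have hcont : Continuous fun x => ∑' k : ι → ℤ, g (x + intVec k) := by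
    rw [continuous_iff_continuousAt]
    intro x
    obtain ⟨u, hu, hb⟩ := hbound (‖x‖ + 1)
    have : ContinuousOn (fun x => ∑' k : ι → ℤ, g (x + intVec k)) (Metric.ball 0 (‖x‖ + 1)) :=
      continuousOn_tsum (fun k => (hg.comp (continuous_id.add continuous_const)).continuousOn) hu
        fun k y hy => hb y k (by simpa using (mem_ball_zero_iff.1 hy).le)
    exact this.continuousAt (Metric.isOpen_ball.mem_nhds (by simp))
  have hper : ∀ (x y : ι → ℝ), (fun i => (x i : UnitAddCircle)) = (fun i => (y i : UnitAddCircle)) →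
      ∑' k : ι → ℤ, g (x + intVec k) = ∑' k : ι → ℤ, g (y + intVec k) := by
    intro x y hxy
    have : ∀ i, ∃ n : ℤ, y i = x i + n := by
      intro i
      have h := congrFun hxy i
      rw [eq_comm, ← sub_eq_zero, ← AddCircle.coe_sub, AddCircle.coe_eq_zero_iff] at h
      obtain ⟨n, hn⟩ := h
      exact ⟨n, by simp at hn; linarith⟩
    choose n hn using this
    have hy : y = x + intVec n := by ext i; exact hn i
    rw [hy, ← (Equiv.addLeft n).tsum_eq]
    congr 1; ext k
    congr 1; ext i
    simp [intVec, add_assoc]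
  have hq : IsOpenQuotientMap fun (x : ι → ℝ) (i : ι) => (x i : UnitAddCircle) :=
    IsOpenQuotientMap.piMap fun _ => QuotientAddGroup.isOpenQuotientMap_mk
  let F : C(UnitAddTorus ι, ℂ) := ⟨fun t => ∑' k : ι → ℤ, g (Function.surjInv hq.surjective t +
    intVec k), by
      rw [hq.isQuotientMap.continuous_iff]
      convert hcont using 2 with x
      exact hper _ _ (Function.surjInv_eq hq.surjective _)⟩
  have hF : ∀ x : ι → ℝ, F (fun i => (x i : UnitAddCircle)) = ∑' k : ι → ℤ, g (x + intVec k) :=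
    fun x => hper _ _ (Function.surjInv_eq hq.surjective _)
  obtain ⟨u, hu, hb⟩ := hbound 1
  have hcube : ∀ x ∈ unitCube ι, ‖x‖ ≤ 1 := by
    intro x hx
    rw [pi_norm_le_iff_of_nonneg zero_le_one]
    intro i
    have := hx i trivial
    rw [Real.norm_eq_abs, abs_le]
    exact ⟨by linarith [this.1], this.2⟩
  have h_int : Integrable g := by
    refine ⟨hg.aestronglyMeasurable, ?_⟩
    rw [HasFiniteIntegral, ← tsum_lintegral_unitCube_add]
    refine lt_of_le_of_lt (ENNReal.tsum_le_tsum (g := fun k => ENNReal.ofReal (u k)) fun k => ?_) ?_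
    · refine (setLIntegral_mono (g := fun _ => ENNReal.ofReal (u k)) measurable_const
        fun x hx => ?_).trans ?_
      · rw [← ofReal_norm]
        exact ENNReal.ofReal_le_ofReal (hb x k (hcube x hx))
      · simp [volume_unitCube]
    · have hu0 : ∀ k, 0 ≤ u k := fun k => (norm_nonneg _).trans (hb 0 k (by simp))
      rw [← ENNReal.ofReal_tsum_of_nonneg hu0 hu]
      exact ENNReal.ofReal_lt_top
  have hcoeff : ∀ n : ι → ℤ, UnitAddTorus.mFourierCoeff F n = ∫ x, intChar (-n) x * g x := by
    intro n
    have h_int' : Integrable fun x => intChar (-n) x * g x :=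
      h_int.bdd_mul (c := 1) (continuous_intChar _).aestronglyMeasurable
        (.of_forall fun x => (norm_intChar _ x).le)
    rw [UnitAddTorus.mFourierCoeff_eq_integral F n 0]
    have hset : {x : ι → ℝ | ∀ i, x i ∈ Set.Ioc ((0 : ι → ℝ) i) ((0 : ι → ℝ) i + 1)} =
        unitCube ι := by
      ext x; simp [unitCube]
    rw [hset, ← (hasSum_integral_unitCube_add h_int').tsum_eq]
    have h1 : ∀ x : ι → ℝ, UnitAddTorus.mFourier (-n) (fun i => (x i : UnitAddCircle)) •
        F (fun i => (x i : UnitAddCircle)) =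
        ∑' k : ι → ℤ, intChar (-n) (x + intVec k) * g (x + intVec k) := by
      intro x
      simp_rw [intChar_add_intVec, hF, smul_eq_mul, tsum_mul_left]
      rfl
    simp_rw [h1]
    have hbd : ∀ (k : ι → ℤ), ∀ x ∈ unitCube ι,
        ‖intChar (-n) (x + intVec k) * g (x + intVec k)‖ ≤ u k := by
      intro k x hx
      rw [norm_mul, norm_intChar, one_mul]
      exact hb x k (hcube x hx)
    have hfin : IsFiniteMeasure (volume.restrict (unitCube ι)) :=
      ⟨by simp [volume_unitCube]⟩
    have hci : ∀ k : ι → ℤ, Continuous fun x => intChar (-n) (x + intVec k) * g (x + intVec k) :=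
      fun k => ((continuous_intChar _).comp (continuous_id.add continuous_const)).mul
        (hg.comp (continuous_id.add continuous_const))
    refine integral_tsum_of_summable_integral_norm (fun k => ?_) ?_ |>.symm
    · exact Measure.integrableOn_of_bounded (M := u k) (by simp [volume_unitCube])
        (hci k).aestronglyMeasurable
        ((ae_restrict_iff' measurableSet_unitCube).2 (.of_forall (hbd k)))
    · refine Summable.of_nonneg_of_le (fun k => by positivity) (fun k => ?_) hu
      have := norm_setIntegral_le_of_norm_le_const (μ := volume) (s := unitCube ι)
        (f := fun x => ‖intChar (-n) (x + intVec k) * g (x + intVec k)‖) (C := u k)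
        (by simp [volume_unitCube]) (fun x hx => by simpa using hbd k x hx)
      refine (le_abs_self _).trans (this.trans ?_)
      simp [measureReal_def, volume_unitCube]
  have hs : Summable (UnitAddTorus.mFourierCoeff F) := by
    convert hsum using 1
    ext n; exact hcoeff n
  have := (UnitAddTorus.hasSum_mFourier_series_apply_of_summable hs
    (fun i => ((0 : ι → ℝ) i : UnitAddCircle))).tsum_eq
  rw [hF] at this
  simp only [zero_add] at this
  rw [← this]
  congr 1; ext n
  rw [hcoeff]
  have h1 : UnitAddTorus.mFourier n (fun i => ((0 : ι → ℝ) i : UnitAddCircle)) = 1 := by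
    have := intChar_eq n 0
    simpa [intChar] using this
  rw [h1, smul_eq_mul, mul_one]

end poisson

section gaussian
variable {ι : Type*} [Fintype ι]

lemma summable_exp_neg_mul_sum_sq {a : ℝ} (ha : 0 < a) :
    Summable fun k : ι → ℤ => Real.exp (-a * ∑ i, (k i : ℝ) ^ 2) := by
  classical
  have h1 : Summable fun n : ℤ => Real.exp (-a * (n : ℝ) ^ 2) := by
    refine (summable_int_iff_summable_nat_and_neg.2 ?_)
    have : Summable fun n : ℕ => Real.exp (-a * (n : ℝ) ^ 2) := by
      refine Summable.of_nonneg_of_le (fun n => (Real.exp_pos _).le) (fun n => ?_)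
        (Real.summable_exp_nat_mul_iff.2 (neg_lt_zero.2 ha))
      apply Real.exp_le_exp.2
      have : (n : ℝ) ≤ (n : ℝ) ^ 2 := by
        rcases Nat.eq_zero_or_pos n with rfl | hn
        · simp
        · have : (1 : ℝ) ≤ n := by exact_mod_cast hn
          nlinarith
      nlinarith
    exact ⟨by simpa using this, by simpa using this⟩
  refine summable_of_sum_le (c := (∑' n : ℤ, Real.exp (-a * (n : ℝ) ^ 2)) ^ Fintype.card ι)
    (fun k => (Real.exp_pos _).le) fun u => ?_
  calc ∑ k ∈ u, Real.exp (-a * ∑ i, (k i : ℝ) ^ 2)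
      ≤ ∑ k ∈ Fintype.piFinset fun i => u.image fun l : ι → ℤ => l i,
          Real.exp (-a * ∑ i, ((k : ι → ℤ) i : ℝ) ^ 2) := by
        refine Finset.sum_le_sum_of_subset_of_nonneg (fun k hk => ?_)
          fun _ _ _ => (Real.exp_pos _).le
        exact Fintype.mem_piFinset.2 fun i => Finset.mem_image_of_mem _ hk
    _ = ∏ i, ∑ n ∈ u.image fun l : ι → ℤ => l i, Real.exp (-a * (n : ℝ) ^ 2) := by
        rw [Finset.prod_univ_sum]
        refine Finset.sum_congr rfl fun k _ => ?_
        rw [Finset.mul_sum, Real.exp_sum]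
    _ ≤ ∏ _i : ι, ∑' n : ℤ, Real.exp (-a * (n : ℝ) ^ 2) :=
        Finset.prod_le_prod (fun i _ => Finset.sum_nonneg fun _ _ => (Real.exp_pos _).le)
          fun i _ => h1.sum_le_tsum _ fun _ _ => (Real.exp_pos _).le
    _ = _ := by simp

lemma one_le_sum_sq_of_ne_zero {k : ι → ℤ} (hk : k ≠ 0) : 1 ≤ ∑ i, (k i : ℝ) ^ 2 := by
  obtain ⟨i, hi⟩ := Function.ne_iff.1 hk
  have h1 : (1 : ℝ) ≤ (k i : ℝ) ^ 2 := by
    have : (1 : ℤ) ≤ (k i) ^ 2 := Int.add_one_le_of_lt (sq_pos_of_ne_zero hi)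
    exact_mod_cast this
  exact h1.trans (Finset.single_le_sum (f := fun i => (k i : ℝ) ^ 2)
    (fun i _ => sq_nonneg _) (Finset.mem_univ i))

variable {V : Type*} [NormedAddCommGroup V] [InnerProductSpace ℝ V] [FiniteDimensional ℝ V]

omit [FiniteDimensional ℝ V] in
lemma sum_sq_le_of_inner_eq (b : ι → V) {w : V} {k : ι → ℝ}
    (h : ∀ i, inner ℝ w (b i) = k i) :
    ∑ i, (k i) ^ 2 ≤ ‖w‖ ^ 2 * ∑ i, ‖b i‖ ^ 2 := by
  rw [Finset.mul_sum]
  refine Finset.sum_le_sum fun i _ => ?_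
  rw [← h i, ← mul_pow, sq_le_sq, abs_of_nonneg (by positivity : 0 ≤ ‖w‖ * ‖b i‖)]
  exact abs_real_inner_le_norm _ _

omit [Fintype ι] in
lemma exists_inner_basis_eq (b : Module.Basis ι ℝ V) (k : ι → ℝ) :
    ∃ w : V, ∀ i, inner ℝ w (b i) = k i := by
  refine ⟨(InnerProductSpace.toDual ℝ V).symm
    (LinearMap.toContinuousLinearMap (b.constr ℝ k)), fun i => ?_⟩
  rw [InnerProductSpace.toDual_symm_apply]
  exact b.constr_basis ℝ k i

lemma exists_pos_mul_sum_sq_le (b : Module.Basis ι ℝ V) :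
    ∃ c : ℝ, 0 < c ∧ ∀ x : ι → ℝ, c * ∑ i, x i ^ 2 ≤ ‖∑ i, x i • b i‖ ^ 2 := by
  choose w hw using fun i : ι => exists_inner_basis_eq b (by classical exact Pi.single i 1)
  refine ⟨(1 + ∑ i, ‖w i‖ ^ 2)⁻¹, by positivity, fun x => ?_⟩
  have h : ∀ i, inner ℝ (∑ i, x i • b i) (w i) = x i := by
    classical
    intro i
    rw [real_inner_comm, inner_sum]
    simp only [inner_smul_right, hw]
    rw [Finset.sum_eq_single i] <;> simp +contextual
  have := sum_sq_le_of_inner_eq w h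
  rw [inv_mul_le_iff₀ (by positivity)]
  nlinarith [sq_nonneg ‖∑ i, x i • b i‖]

variable [MeasurableSpace V] [BorelSpace V]

/-- Poisson summation for Gaussians on a lattice: the vectors `w k` run over the dual lattice. -/
theorem exists_dual_tsum_gaussian (b : Module.Basis ι ℝ V) :
    ∃ w : (ι → ℤ) → V, (∀ k i, inner ℝ (w k) (b i) = k i) ∧
      Summable (fun k : ι → ℤ => Real.exp (-Real.pi * ‖w k‖ ^ 2)) ∧
      Summable (fun k : ι → ℤ => Real.exp (-Real.pi * ‖∑ i, (k i : ℝ) • b i‖ ^ 2)) ∧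
      ∑' k : ι → ℤ, Real.exp (-Real.pi * ‖∑ i, (k i : ℝ) • b i‖ ^ 2) =
        (∫ x : ι → ℝ, Real.exp (-Real.pi * ‖∑ i, x i • b i‖ ^ 2)) *
          ∑' k : ι → ℤ, Real.exp (-Real.pi * ‖w k‖ ^ 2) := by
  choose w hw using fun k : ι → ℤ => exists_inner_basis_eq b fun i => (k i : ℝ)
  obtain ⟨c, hc, hcb⟩ := exists_pos_mul_sum_sq_le b
  have hpi := Real.pi_pos
  have hsw : Summable (fun k : ι → ℤ => Real.exp (-Real.pi * ‖w k‖ ^ 2)) := by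
    refine Summable.of_nonneg_of_le (fun _ => (Real.exp_pos _).le) (fun k => ?_)
      (summable_exp_neg_mul_sum_sq (ι := ι) (a := Real.pi * (1 + ∑ i, ‖b i‖ ^ 2)⁻¹)
        (by positivity))
    apply Real.exp_le_exp.2
    have h := sum_sq_le_of_inner_eq b (hw k)
    have h2 : (1 + ∑ i, ‖b i‖ ^ 2)⁻¹ * ∑ i, (k i : ℝ) ^ 2 ≤ ‖w k‖ ^ 2 := by
      rw [inv_mul_le_iff₀ (by positivity)]
      nlinarith [sq_nonneg ‖w k‖]
    nlinarith
  have hsb : Summable (fun k : ι → ℤ => Real.exp (-Real.pi * ‖∑ i, (k i : ℝ) • b i‖ ^ 2)) := by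
    refine Summable.of_nonneg_of_le (fun _ => (Real.exp_pos _).le) (fun k => ?_)
      (summable_exp_neg_mul_sum_sq (ι := ι) (a := Real.pi * c) (by positivity))
    apply Real.exp_le_exp.2
    have := hcb fun i => (k i : ℝ)
    nlinarith
  refine ⟨w, hw, hsw, hsb, ?_⟩
  let T : (ι → ℝ) ≃L[ℝ] V := b.equivFun.symm.toContinuousLinearEquiv
  have hT : ∀ x, T x = ∑ i, x i • b i := fun x => b.equivFun_symm_apply x
  have hmap : ∃ a : NNReal, (volume : Measure (ι → ℝ)).map T = a • (volume : Measure V) := by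
    have : Measure.IsAddHaarMeasure ((volume : Measure (ι → ℝ)).map T) :=
      T.isAddHaarMeasure_map volume
    exact ⟨_, Measure.isAddLeftInvariant_eq_smul _ _⟩
  obtain ⟨a, hmap⟩ := hmap
  have hcv : ∀ h : V → ℂ, ∫ x, h (T x) = (a : ℂ) * ∫ v, h v := by
    intro h
    have h1 : ∫ y, h y ∂(volume.map T) = ∫ x, h (T x) :=
      T.toHomeomorph.measurableEmbedding.integral_map h
    rw [← h1, hmap, integral_smul_nnreal_measure]
    simp [NNReal.smul_def]
  have hF : ∀ k : ι → ℤ,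
      ∫ x, intChar (-k) x * ((Real.exp (-Real.pi * ‖∑ i, x i • b i‖ ^ 2) : ℝ) : ℂ) =
        (a : ℂ) * (Real.exp (-Real.pi * ‖w k‖ ^ 2) : ℝ) := by
    intro k
    have h1 := hcv fun v => Complex.exp (((-2 * Real.pi * inner ℝ v (w k) : ℝ) : ℂ) * Complex.I) *
      Complex.exp (-(Real.pi : ℂ) * ‖v‖ ^ 2)
    have h2 := fourier_gaussian_innerProductSpace (V := V) (b := (Real.pi : ℂ))
      (by simpa using hpi) (w k)
    rw [Real.fourier_eq'] at h2
    simp only [smul_eq_mul] at h2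
    rw [h2] at h1
    convert h1 using 2
    · ext x
      rw [intChar_eq, hT]
      push_cast
      congr 2
      rw [real_inner_comm, inner_sum]
      simp only [inner_smul_right, hw]
      push_cast
      simp only [Finset.mul_sum, Finset.sum_mul, Pi.neg_apply]
      refine Finset.sum_congr rfl fun i _ => ?_
      push_cast
      ring
    · have hpc : (Real.pi : ℂ) ≠ 0 := by exact_mod_cast hpi.ne'
      rw [div_self hpc, Complex.one_cpow, one_mul]
      push_cast
      congr 1
      field_simp
  have hI : (∫ x : ι → ℝ, Real.exp (-Real.pi * ‖∑ i, x i • b i‖ ^ 2)) = a := by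
    have h0 := hF 0
    have hw0 : w 0 = 0 := by
      have : ∀ v, inner ℝ (w 0) v = 0 := by
        intro v
        rw [← b.sum_repr v, inner_sum]
        simp [inner_smul_right, hw]
      exact inner_self_eq_zero.1 (this (w 0))
    simp only [intChar_eq, hw0] at h0
    simp only [neg_zero, Pi.zero_apply, Int.cast_zero, zero_mul, Finset.sum_const_zero, mul_zero,
      Complex.exp_zero, one_mul, norm_zero, ne_eq, OfNat.ofNat_ne_zero, not_false_eq_true, zero_pow,
      Real.exp_zero, Complex.ofReal_one, mul_one] at h0
    rw [integral_complex_ofReal] at h0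
    exact_mod_cast h0
  have hP := tsum_intVec_eq_tsum_integral_intChar
    (g := fun x : ι → ℝ => ((Real.exp (-Real.pi * ‖∑ i, x i • b i‖ ^ 2) : ℝ) : ℂ))
    (by fun_prop) (fun R => ?_) ?_
  · rw [hI]
    simp only [hF, intVec] at hP
    rw [tsum_mul_left, ← Complex.ofReal_tsum, ← Complex.ofReal_tsum] at hP
    exact_mod_cast hP
  · refine ⟨fun k => Real.exp (Real.pi * c * Fintype.card ι * R ^ 2) *
      Real.exp (-(Real.pi * c / 2) * ∑ i, (k i : ℝ) ^ 2),
      (summable_exp_neg_mul_sum_sq (by positivity)).mul_left _, fun x k hx => ?_⟩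
    beta_reduce
    rw [Complex.norm_real, Real.norm_eq_abs, abs_of_pos (Real.exp_pos _), ← Real.exp_add]
    apply Real.exp_le_exp.2
    have h1 := hcb (x + intVec k)
    have h2 : ∑ i, ((k i : ℝ) ^ 2 / 2 - R ^ 2) ≤ ∑ i, (x + intVec k) i ^ 2 := by
      refine Finset.sum_le_sum fun i _ => ?_
      have h3 : |x i| ≤ R := (norm_le_pi_norm x i).trans hx
      have h4 : x i ^ 2 ≤ R ^ 2 := by
        rw [← sq_abs]; exact pow_le_pow_left₀ (abs_nonneg _) h3 2
      simp only [Pi.add_apply, intVec]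
      nlinarith [sq_nonneg (2 * x i + k i)]
    rw [Finset.sum_sub_distrib, ← Finset.sum_div, Finset.sum_const, Finset.card_univ,
      nsmul_eq_mul] at h2
    have h5 := mul_le_mul_of_nonneg_left h2 hc.le
    nlinarith [mul_le_mul_of_nonneg_left (h5.trans h1) hpi.le]
  · simp only [hF]
    exact (Complex.hasSum_ofReal.2 hsw.hasSum).summable.mul_left _

end gaussian

section volume
variable {ι : Type*} [Fintype ι] {V : Type*} [NormedAddCommGroup V] [NormedSpace ℝ V]
  [FiniteDimensional ℝ V] [MeasurableSpace V] [BorelSpace V]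

omit [FiniteDimensional ℝ V] in
lemma integral_basis_mul_volume_fundamentalDomain (μ : Measure V) [μ.IsAddHaarMeasure]
    (b : Module.Basis ι ℝ V) (h : V → ℝ) :
    (∫ x : ι → ℝ, h (∑ i, x i • b i)) * (μ (ZSpan.fundamentalDomain b)).toReal = ∫ v, h v ∂μ := by
  let T : (ι → ℝ) ≃L[ℝ] V := b.equivFun.symm.toContinuousLinearEquiv
  have hT : ∀ x, T x = ∑ i, x i • b i := fun x => b.equivFun_symm_apply x
  have : Measure.IsAddHaarMeasure (μ.map T.symm) := T.symm.isAddHaarMeasure_map μ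
  have hmap := Measure.isAddLeftInvariant_eq_smul (μ.map T.symm) (volume : Measure (ι → ℝ))
  set a := Measure.addHaarScalarFactor (μ.map T.symm) (volume : Measure (ι → ℝ))
  have hcube : (μ.map T.symm) (Set.univ.pi fun _ => Set.Ico 0 1) = a := by
    rw [hmap, Measure.smul_apply, volume_pi_pi]
    simp [ENNReal.smul_def]
  have hD : (μ.map T.symm) (Set.univ.pi fun _ => Set.Ico 0 1) =
      μ (ZSpan.fundamentalDomain b) := by
    refine (T.symm.toHomeomorph.measurableEmbedding.map_apply μ _).trans ?_
    congr 1
    ext v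
    simp only [ZSpan.mem_fundamentalDomain, Set.mem_preimage, Set.mem_univ_pi]
    rfl
  have h1 : ∫ x, h (T x) ∂(μ.map T.symm) = ∫ v, h (T (T.symm v)) ∂μ :=
    T.symm.toHomeomorph.measurableEmbedding.integral_map _
  simp only [T.apply_symm_apply, hmap, integral_smul_nnreal_measure, hT] at h1
  rw [← h1, ← hD, hcube, NNReal.smul_def, smul_eq_mul, mul_comm]
  simp

end volume

section place
open NumberField.InfinitePlace NumberField.mixedEmbedding
variable (L : Type*) [Field L] [NumberField L]

/-- The linear automorphism of the mixed space scaling the place `w` by `t w`. -/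
noncomputable def scalePlaces (t : InfinitePlace L → ℝ) (ht : ∀ w, t w ≠ 0) :
    mixedSpace L ≃ₗ[ℝ] mixedSpace L :=
  (LinearEquiv.piCongrRight fun w => LinearEquiv.smulOfNeZero ℝ ℝ (t w.1) (ht w.1)).prodCongr
    (LinearEquiv.piCongrRight fun w => LinearEquiv.smulOfNeZero ℝ ℂ (t w.1) (ht w.1))

variable {L}

omit [NumberField L] in
lemma normAtPlace_scalePlaces (t : InfinitePlace L → ℝ) (ht : ∀ w, t w ≠ 0)
    (w : InfinitePlace L) (x : mixedSpace L) :
    normAtPlace w (scalePlaces L t ht x) = |t w| * normAtPlace w x := by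
  by_cases hw : IsReal w
  · simp [normAtPlace_apply_of_isReal hw, scalePlaces]
  · rw [not_isReal_iff_isComplex] at hw
    simp [normAtPlace_apply_of_isComplex hw, scalePlaces]

open scoped Classical in
lemma sum_places_eq (f : InfinitePlace L → ℝ) : ∑ w, f w =
    ∑ w : {w : InfinitePlace L // IsReal w}, f w +
      ∑ w : {w : InfinitePlace L // IsComplex w}, f w := by
  rw [← Fintype.sum_subtype_add_sum_subtype (fun w => IsReal w) f]
  congr 1
  exact Fintype.sum_equiv (Equiv.subtypeEquivRight fun w => not_isReal_iff_isComplex) _ _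
    fun _ => rfl

open scoped Classical in
lemma prod_places_eq (f : InfinitePlace L → ℝ) : ∏ w, f w =
    (∏ w : {w : InfinitePlace L // IsReal w}, f w) *
      ∏ w : {w : InfinitePlace L // IsComplex w}, f w := by
  rw [← Fintype.prod_subtype_mul_prod_subtype (fun w => IsReal w) f]
  congr 1
  exact Fintype.prod_equiv (Equiv.subtypeEquivRight fun w => not_isReal_iff_isComplex) _ _
    fun _ => rfl

open scoped Classical in
lemma norm_toMixed_symm_sq (x : mixedSpace L) :
    ‖(euclidean.toMixed L).symm x‖ ^ 2 = ∑ w, normAtPlace w x ^ 2 := by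
  classical
  rw [WithLp.prod_norm_sq_eq_of_L2, EuclideanSpace.norm_sq_eq, EuclideanSpace.norm_sq_eq,
    sum_places_eq]
  congr 1
  · refine Finset.sum_congr rfl fun w _ => ?_
    rw [normAtPlace_apply_of_isReal w.2]; rfl
  · refine Finset.sum_congr rfl fun w _ => ?_
    rw [normAtPlace_apply_of_isComplex w.2]; rfl

open scoped Classical in
lemma integral_exp_neg_normAtPlace (t : InfinitePlace L → ℝ) (ht : ∀ w, 0 < t w) :
    ∫ x : mixedSpace L, Real.exp (-Real.pi * ∑ w, t w * normAtPlace w x ^ 2) =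
      ∏ w, t w ^ (-(mult w : ℝ) / 2) := by
  classical
  have hpi := Real.pi_pos
  have h1 : ∀ x : mixedSpace L, Real.exp (-Real.pi * ∑ w, t w * normAtPlace w x ^ 2) =
      (∏ w : {w : InfinitePlace L // IsReal w}, Real.exp (-(Real.pi * t w) * ‖x.1 w‖ ^ 2)) *
      ∏ w : {w : InfinitePlace L // IsComplex w}, Real.exp (-(Real.pi * t w) * ‖x.2 w‖ ^ 2) := by
    intro x
    rw [← Real.exp_sum, ← Real.exp_sum, ← Real.exp_add, sum_places_eq, mul_add, Finset.mul_sum,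
      Finset.mul_sum]
    congr 2
    · refine Finset.sum_congr rfl fun w _ => ?_
      rw [normAtPlace_apply_of_isReal w.2]; ring
    · refine Finset.sum_congr rfl fun w _ => ?_
      rw [normAtPlace_apply_of_isComplex w.2]; ring
  simp only [h1]
  rw [Measure.volume_eq_prod, integral_prod_mul
    (fun x : {w : InfinitePlace L // IsReal w} → ℝ =>
      ∏ w : {w : InfinitePlace L // IsReal w}, Real.exp (-(Real.pi * t w) * ‖x w‖ ^ 2))
    (fun x : {w : InfinitePlace L // IsComplex w} → ℂ =>
      ∏ w : {w : InfinitePlace L // IsComplex w}, Real.exp (-(Real.pi * t w) * ‖x w‖ ^ 2)),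
    integral_fintype_prod_volume_eq_prod (fun (w : {w : InfinitePlace L // IsReal w}) (x : ℝ) =>
      Real.exp (-(Real.pi * t w) * ‖x‖ ^ 2)),
    integral_fintype_prod_volume_eq_prod (fun (w : {w : InfinitePlace L // IsComplex w}) (x : ℂ) =>
      Real.exp (-(Real.pi * t w) * ‖x‖ ^ 2)), prod_places_eq]
  congr 1
  · refine Finset.prod_congr rfl fun w _ => ?_
    rw [GaussianFourier.integral_rexp_neg_mul_sq_norm (mul_pos hpi (ht _)), mult_isReal w,
      div_mul_cancel_left₀ hpi.ne', Real.inv_rpow (ht _).le, ← Real.rpow_neg (ht _).le]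
    simp
    ring_nf
  · refine Finset.prod_congr rfl fun w _ => ?_
    rw [GaussianFourier.integral_rexp_neg_mul_sq_norm (mul_pos hpi (ht _)), mult_isComplex w,
      div_mul_cancel_left₀ hpi.ne', Real.inv_rpow (ht _).le, ← Real.rpow_neg (ht _).le]
    simp

end place

section idealTheta
open NumberField.InfinitePlace NumberField.mixedEmbedding
variable {L : Type} [Field L] [NumberField L]

/-- The covolume of an ideal in the mixed space. -/
noncomputable def idealCovolume (J : (Ideal (𝓞 L))⁰) : ℝ :=
  Ideal.absNorm (J : Ideal (𝓞 L)) * (2⁻¹ : ℝ) ^ nrComplexPlaces L * √|discr L|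

lemma idealCovolume_pos (J : (Ideal (𝓞 L))⁰) : 0 < idealCovolume J := by
  have h1 : 0 < Ideal.absNorm (J : Ideal (𝓞 L)) := Ideal.absNorm_pos_of_nonZeroDivisors J
  have h2 : (0 : ℝ) < |(discr L : ℝ)| := abs_pos.2 (by exact_mod_cast discr_ne_zero L)
  exact mul_pos (mul_pos (by exact_mod_cast h1) (by positivity)) (Real.sqrt_pos.2 h2)

open scoped Classical in
lemma exists_lattice_parametrization (J : (Ideal (𝓞 L))⁰) :
    ∃ (ι : Type) (_ : Fintype ι) (B : Module.Basis ι ℝ (mixedSpace L))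
      (e : (ι → ℤ) ≃ (J : Ideal (𝓞 L))), e 0 = 0 ∧
      (∀ k, mixedEmbedding L ((e k : 𝓞 L) : L) = ∑ i, (k i : ℝ) • B i) ∧
      (volume (ZSpan.fundamentalDomain B)).toReal = idealCovolume J := by
  set I := FractionalIdeal.mk0 L J with hI
  let β := fractionalIdealBasis L (I : FractionalIdeal (𝓞 L)⁰ L)
  have hmem : ∀ x : ((I : FractionalIdeal (𝓞 L)⁰ L)), ∃ y : (J : Ideal (𝓞 L)),
      algebraMap (𝓞 L) L y = x := by
    rintro ⟨x, hx⟩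
    rw [hI, FractionalIdeal.coe_mk0, FractionalIdeal.mem_coeIdeal] at hx
    obtain ⟨y, hy, rfl⟩ := hx
    exact ⟨⟨y, hy⟩, rfl⟩
  choose g hg using hmem
  have hg_bij : Function.Bijective g := by
    constructor
    · intro x y hxy
      apply Subtype.ext
      rw [← hg, ← hg, hxy]
    · intro y
      have hy : algebraMap (𝓞 L) L y ∈ (I : FractionalIdeal (𝓞 L)⁰ L) := by
        rw [hI, FractionalIdeal.coe_mk0, FractionalIdeal.mem_coeIdeal]
        exact ⟨y, y.2, rfl⟩
      refine ⟨⟨_, hy⟩, Subtype.ext (RingOfIntegers.coe_injective ?_)⟩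
      exact hg ⟨_, hy⟩
  have hcoe : ∀ k, ((β.equivFun.symm k : (I : FractionalIdeal (𝓞 L)⁰ L)) : L) =
      ∑ i, k i • basisOfFractionalIdeal L I i := by
    intro k
    rw [β.equivFun_symm_apply]
    simp [β, basisOfFractionalIdeal_apply]
  refine ⟨_, inferInstance, fractionalIdealLatticeBasis L I,
    β.equivFun.symm.toEquiv.trans (Equiv.ofBijective g hg_bij), ?_, fun k => ?_, ?_⟩
  · apply Subtype.ext
    apply RingOfIntegers.coe_injective
    refine (hg _).trans ?_
    rw [LinearEquiv.coe_toEquiv, hcoe]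
    simp
  · have : ((((β.equivFun.symm.toEquiv.trans (Equiv.ofBijective g hg_bij)) k :
        (J : Ideal (𝓞 L))) : 𝓞 L) : L) = ∑ i, k i • basisOfFractionalIdeal L I i :=
      (hg _).trans (hcoe k)
    rw [this, map_sum]
    refine Finset.sum_congr rfl fun i _ => ?_
    rw [fractionalIdealLatticeBasis_apply, map_zsmul, Int.cast_smul_eq_zsmul]
  · have h := covolume_idealLattice L I
    rw [ZLattice.covolume_eq_measure_fundamentalDomain _ _ (fundamentalDomain_idealLattice L I)]
      at h
    rw [idealCovolume, ← measureReal_def, h]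
    simp [hI, FractionalIdeal.coeIdeal_absNorm]

/-- The quadratic form `∑ w, t w * ‖α‖_w ^ 2` on the integers of a number field. -/
noncomputable def placeForm (t : InfinitePlace L → ℝ) (α : 𝓞 L) : ℝ :=
  ∑ w, t w * w (α : L) ^ 2

theorem exists_ideal_poisson (J : (Ideal (𝓞 L))⁰) :
    ∃ (ι : Type) (_ : Fintype ι) (e : (ι → ℤ) ≃ (J : Ideal (𝓞 L))) (c B : ℝ),
      0 < c ∧ 0 < B ∧ e 0 = 0 ∧
      (∀ (t : InfinitePlace L → ℝ) (ε : ℝ), 0 ≤ ε → (∀ w, ε ≤ t w) →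
        ∀ k, ε * (c * ∑ i, (k i : ℝ) ^ 2) ≤ placeForm t (e k)) ∧
      ∀ t : InfinitePlace L → ℝ, (∀ w, 0 < t w) → ∃ W : (ι → ℤ) → ℝ, W 0 = 0 ∧
        (∀ T, (∀ w, t w ≤ T) → ∀ k, ∑ i, (k i : ℝ) ^ 2 ≤ W k * (T * B)) ∧
        Summable (fun k => Real.exp (-Real.pi * W k)) ∧
        Summable (fun k => Real.exp (-Real.pi * placeForm t (e k))) ∧
        ∑' k, Real.exp (-Real.pi * placeForm t (e k)) =
          (∏ w, t w ^ (-(mult w : ℝ) / 2)) / idealCovolume J *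
            ∑' k, Real.exp (-Real.pi * W k) := by
  classical
  obtain ⟨ι, _, b, e, he0, he, hvol⟩ := exists_lattice_parametrization J
  let E : mixedSpace L ≃ₗ[ℝ] euclidean.mixedSpace L := (euclidean.toMixed L).symm.toLinearEquiv
  have hE : ∀ x, ‖E x‖ ^ 2 = ∑ w, normAtPlace w x ^ 2 := norm_toMixed_symm_sq
  obtain ⟨c, hc, hcb⟩ := exists_pos_mul_sum_sq_le (b.map E)
  have hek : ∀ (k : ι → ℤ) w, normAtPlace w (∑ i, (k i : ℝ) • b i) = w ((e k : 𝓞 L) : L) := by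
    intro k w
    rw [← he, normAtPlace_apply]
  have hscale : ∀ (t : InfinitePlace L → ℝ) (ht : ∀ w, 0 < t w) (x : ι → ℝ),
      ‖∑ i, x i • ((b.map (scalePlaces L (fun w => √(t w))
        fun w => (Real.sqrt_pos.2 (ht w)).ne')).map E) i‖ ^ 2 =
      ∑ w, t w * normAtPlace w (∑ i, x i • b i) ^ 2 := by
    intro t ht x
    simp only [Module.Basis.map_apply]
    simp only [← map_smul, ← map_sum]
    rw [hE]
    refine Finset.sum_congr rfl fun w _ => ?_
    rw [normAtPlace_scalePlaces, mul_pow, sq_abs, Real.sq_sqrt (ht w).le]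
  refine ⟨ι, inferInstance, e, c, 1 + ∑ i, ‖E (b i)‖ ^ 2, hc, by positivity, he0, ?_, ?_⟩
  · intro t ε hε ht k
    have h := hcb fun i => (k i : ℝ)
    simp only [Module.Basis.map_apply, ← map_smul, ← map_sum, hE, hek] at h
    refine (mul_le_mul_of_nonneg_left h hε).trans ?_
    rw [Finset.mul_sum, placeForm]
    exact Finset.sum_le_sum fun w _ => mul_le_mul_of_nonneg_right (ht w) (sq_nonneg _)
  · intro t ht
    set b' := (b.map (scalePlaces L (fun w => √(t w))
        fun w => (Real.sqrt_pos.2 (ht w)).ne')).map E with hb'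
    obtain ⟨w, hw, hsw, hsb, hP⟩ := exists_dual_tsum_gaussian b'
    have hform : ∀ k : ι → ℤ, ‖∑ i, (k i : ℝ) • b' i‖ ^ 2 = placeForm t (e k) := by
      intro k
      rw [hscale t ht]
      simp only [hek, placeForm]
    simp only [hform] at hsb hP
    refine ⟨fun k => ‖w k‖ ^ 2, ?_, fun T hT k => ?_, hsw, hsb, ?_⟩
    · have : ∀ v, inner ℝ (w 0) v = 0 := by
        intro v
        rw [← b'.sum_repr v, inner_sum]
        simp [inner_smul_right, hw]
      have h0 : w 0 = 0 := inner_self_eq_zero.1 (this (w 0))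
      simp [h0]
    · refine (sum_sq_le_of_inner_eq b' (hw k)).trans ?_
      refine mul_le_mul_of_nonneg_left ?_ (sq_nonneg _)
      have hT0 : 0 ≤ T := by
        obtain ⟨v⟩ : Nonempty (InfinitePlace L) := inferInstance
        exact (ht v).le.trans (hT v)
      have h1 : ∑ i, ‖b' i‖ ^ 2 ≤ T * ∑ i, ‖E (b i)‖ ^ 2 := by
        rw [Finset.mul_sum]
        refine Finset.sum_le_sum fun i _ => ?_
        have := hscale t ht (Pi.single i 1)
        rw [Fintype.sum_eq_single i (by intro j hj; simp [hj]),
          Fintype.sum_eq_single i (by intro j hj; simp [hj])] at this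
        simp only [Pi.single_eq_same, one_smul] at this
        rw [hb', this, hE, Finset.mul_sum]
        exact Finset.sum_le_sum fun w _ => mul_le_mul_of_nonneg_right (hT w) (sq_nonneg _)
      linarith
    · rw [hP]
      congr 1
      have h1 := integral_basis_mul_volume_fundamentalDomain volume b
        fun x => Real.exp (-Real.pi * ∑ w, t w * normAtPlace w x ^ 2)
      rw [hvol, integral_exp_neg_normAtPlace t ht] at h1
      rw [← h1, mul_div_assoc, div_self (idealCovolume_pos J).ne', mul_one]
      simp only [hb', hscale t ht]

end idealTheta

section idealGauss
open NumberField.InfinitePlace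
variable {L : Type} [Field L] [NumberField L]

/-- The sum of `exp (-π * placeForm t α)` over the nonzero elements `α` of `J`. -/
noncomputable def idealGauss (J : (Ideal (𝓞 L))⁰) (t : InfinitePlace L → ℝ) : ENNReal :=
  ∑' α : {α : 𝓞 L // α ∈ (J : Ideal (𝓞 L)) ∧ α ≠ 0},
    ENNReal.ofReal (Real.exp (-Real.pi * placeForm t α))

/-- The main term of `idealGauss J t` as `t` tends to `0`. -/
noncomputable def idealGaussMain (J : (Ideal (𝓞 L))⁰) (t : InfinitePlace L → ℝ) : ℝ :=
  (∏ w, t w ^ (-(mult w : ℝ) / 2)) / idealCovolume J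

lemma placeForm_zero (t : InfinitePlace L → ℝ) : placeForm t (0 : 𝓞 L) = 0 := by
  simp [placeForm]

lemma idealGauss_eq {J : (Ideal (𝓞 L))⁰} {ι : Type} (e : (ι → ℤ) ≃ (J : Ideal (𝓞 L)))
    (he : e 0 = 0) (t : InfinitePlace L → ℝ) :
    idealGauss J t = ∑' k : {k : ι → ℤ // k ≠ 0},
      ENNReal.ofReal (Real.exp (-Real.pi * placeForm t (e k))) := by
  have h0 : ∀ k, k ≠ 0 ↔ ((e k : 𝓞 L) ≠ 0) := by
    intro k
    rw [not_iff_not, ← e.injective.eq_iff, he, ← Subtype.coe_inj]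
    rfl
  refine (Equiv.tsum_eq (Equiv.ofBijective
    (fun k : {k : ι → ℤ // k ≠ 0} => (⟨e k, (e k).2, (h0 k).1 k.2⟩ :
      {α : 𝓞 L // α ∈ (J : Ideal (𝓞 L)) ∧ α ≠ 0})) ⟨?_, ?_⟩)
    fun α => ENNReal.ofReal (Real.exp (-Real.pi * placeForm t α.1))).symm
  · intro k l hkl
    simp only [Subtype.mk.injEq, Subtype.coe_inj] at hkl
    exact Subtype.ext (e.injective hkl)
  · rintro ⟨α, hα, hα0⟩
    obtain ⟨k, hk⟩ := e.surjective ⟨α, hα⟩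
    refine ⟨⟨k, (h0 k).2 (by rw [hk]; exact hα0)⟩, ?_⟩
    simp [hk]

lemma one_add_tsum_ne_zero {ι : Type} {f : (ι → ℤ) → ℝ} (hf : ∀ k, 0 ≤ f k) (h1 : f 0 = 1)
    (hs : Summable f) :
    1 + ∑' k : {k : ι → ℤ // k ≠ 0}, ENNReal.ofReal (f k) = ENNReal.ofReal (∑' k, f k) := by
  classical
  rw [ENNReal.ofReal_tsum_of_nonneg hf hs,
    ENNReal.tsum_eq_add_tsum_ite (f := fun k : ι → ℤ => ENNReal.ofReal (f k)) 0, h1,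
    ENNReal.ofReal_one]
  congr 1
  refine (tsum_subtype {k : ι → ℤ | k ≠ 0} fun k => ENNReal.ofReal (f k)).trans ?_
  refine tsum_congr fun k => ?_
  by_cases hk : k = 0 <;> simp [hk]

lemma idealGaussMain_nonneg (J : (Ideal (𝓞 L))⁰) (t : InfinitePlace L → ℝ)
    (ht : ∀ w, 0 < t w) : 0 ≤ idealGaussMain J t :=
  div_nonneg (Finset.prod_nonneg fun w _ => Real.rpow_nonneg (ht w).le _) (idealCovolume_pos J).le

lemma idealGaussMain_le_one_add (J : (Ideal (𝓞 L))⁰) (t : InfinitePlace L → ℝ)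
    (ht : ∀ w, 0 < t w) : ENNReal.ofReal (idealGaussMain J t) ≤ 1 + idealGauss J t := by
  obtain ⟨ι, _, e, c, B, hc, hB, he, hlow, hP⟩ := exists_ideal_poisson J
  obtain ⟨W, hW0, hW, hsW, hsb, hP⟩ := hP t ht
  rw [idealGauss_eq e he, one_add_tsum_ne_zero (fun _ => (Real.exp_pos _).le)
    (by simp [he, placeForm_zero]) hsb, hP]
  apply ENNReal.ofReal_le_ofReal
  refine le_mul_of_one_le_right (idealGaussMain_nonneg J t ht) ?_
  have := hsW.le_tsum 0 fun _ _ => (Real.exp_pos _).le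
  simpa [hW0] using this

lemma tsum_ne_zero_exp_le {ι : Type} [Fintype ι] {f : (ι → ℤ) → ℝ} {a : ℝ} (ha : 0 < a)
    (hf : ∀ k, a * ∑ i, (k i : ℝ) ^ 2 ≤ f k) {a' : ℝ} (ha' : 0 < a') (haa : a' ≤ a) :
    ∑' k : {k : ι → ℤ // k ≠ 0}, ENNReal.ofReal (Real.exp (-f k)) ≤
      ENNReal.ofReal (Real.exp (-a / 2) *
        ∑' k : ι → ℤ, Real.exp (-(a' / 2) * ∑ i, (k i : ℝ) ^ 2)) := by
  have hs := summable_exp_neg_mul_sum_sq (ι := ι) (a := a' / 2) (by positivity)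
  rw [← tsum_mul_left, ENNReal.ofReal_tsum_of_nonneg
    (fun _ => mul_nonneg (Real.exp_pos _).le (Real.exp_pos _).le) (hs.mul_left _)]
  refine le_trans (ENNReal.tsum_le_tsum fun k => ENNReal.ofReal_le_ofReal ?_)
    (ENNReal.tsum_comp_le_tsum_of_injective Subtype.val_injective _)
  rw [← Real.exp_add]
  apply Real.exp_le_exp.2
  have h1 := one_le_sum_sq_of_ne_zero k.2
  have h2 := hf k
  nlinarith

lemma idealGauss_le_main_add (J : (Ideal (𝓞 L))⁰) {ε A : ℝ} (hε : 0 < ε) (hε1 : ε ≤ 1)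
    (hA : 0 < A) : ∃ C : ℝ, 0 ≤ C ∧ ∀ (τ : ℝ) (t : InfinitePlace L → ℝ), 0 < τ → τ ≤ 1 →
      (∀ w, ε * τ ≤ t w ∧ t w ≤ A * τ) →
      idealGauss J t ≤ ENNReal.ofReal (idealGaussMain J t + C) := by
  classical
  obtain ⟨ι, _, e, c, B, hc, hB, he, hlow, hP⟩ := exists_ideal_poisson J
  have hpi := Real.pi_pos
  have hcov := idealCovolume_pos J
  set n := Fintype.card (InfinitePlace L)
  set a' := Real.pi / (A * B) with ha'
  have ha'0 : 0 < a' := by positivity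
  set Z := ∑' k : ι → ℤ, Real.exp (-(a' / 2) * ∑ i, (k i : ℝ) ^ 2) with hZ
  have hZ0 : 0 ≤ Z := tsum_nonneg fun _ => (Real.exp_pos _).le
  refine ⟨(ε⁻¹) ^ n * (n.factorial / (a' / 2) ^ n) / idealCovolume J * Z, by positivity, ?_⟩
  intro τ t hτ hτ1 ht
  have ht0 : ∀ w, 0 < t w := fun w => (mul_pos hε hτ).trans_le (ht w).1
  obtain ⟨W, hW0, hW, hsW, hsb, hP⟩ := hP t ht0
  rw [← idealGaussMain] at hP
  refine le_trans (self_le_add_left _ 1) ?_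
  rw [idealGauss_eq e he, one_add_tsum_ne_zero (fun _ => (Real.exp_pos _).le)
    (by simp [he, placeForm_zero]) hsb, hP, ENNReal.ofReal_mul (idealGaussMain_nonneg J t ht0),
    ← one_add_tsum_ne_zero (fun _ => (Real.exp_pos _).le) (by simp [hW0]) hsW, mul_add, mul_one,
    ENNReal.ofReal_add (idealGaussMain_nonneg J t ht0) (by positivity)]
  refine add_le_add le_rfl ?_
  have h1 := tsum_ne_zero_exp_le (ι := ι) (f := fun k => Real.pi * W k) (a := a' / τ)
    (by positivity) (fun k => by
      have := hW (A * τ) (fun w => (ht w).2) k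
      rw [ha', div_div, div_mul_eq_mul_div, div_le_iff₀ (by positivity)]
      nlinarith) ha'0 (by rw [le_div_iff₀ hτ]; nlinarith)
  simp only [neg_mul] at h1 ⊢
  refine (mul_le_mul_right h1 _).trans ?_
  rw [← ENNReal.ofReal_mul (idealGaussMain_nonneg J t ht0)]
  apply ENNReal.ofReal_le_ofReal
  simp only [neg_mul] at hZ
  rw [← hZ, ← mul_assoc]
  refine mul_le_mul_of_nonneg_right ?_ hZ0
  rw [idealGaussMain, div_mul_eq_mul_div]
  refine div_le_div_of_nonneg_right ?_ hcov.le
  have h2 : ∏ w, t w ^ (-(mult w : ℝ) / 2) ≤ (ε⁻¹ * τ⁻¹) ^ n := by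
    rw [show (ε⁻¹ * τ⁻¹) ^ n = ∏ _w : InfinitePlace L, (ε⁻¹ * τ⁻¹) by simp [n]]
    refine Finset.prod_le_prod (fun w _ => Real.rpow_nonneg (ht0 w).le _) fun w _ => ?_
    have hm : (mult w : ℝ) ≤ 2 := by
      have : mult w ≤ 2 := by unfold mult; split_ifs <;> norm_num
      exact_mod_cast this
    have hετ : 0 < ε * τ := by positivity
    calc t w ^ (-(mult w : ℝ) / 2) ≤ (ε * τ) ^ (-(mult w : ℝ) / 2) :=
          Real.rpow_le_rpow_of_nonpos hετ (ht w).1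
            (div_nonpos_of_nonpos_of_nonneg (by simp) (by norm_num))
      _ ≤ (ε * τ) ^ (-1 : ℝ) := Real.rpow_le_rpow_of_exponent_ge hετ (by nlinarith) (by linarith)
      _ = ε⁻¹ * τ⁻¹ := by rw [Real.rpow_neg_one, mul_inv]
  have h3 : (τ⁻¹) ^ n * Real.exp (-(a' / τ) / 2) ≤ n.factorial / (a' / 2) ^ n := by
    have h4 := Real.pow_div_factorial_le_exp (x := a' / τ / 2) (by positivity) n
    rw [neg_div, Real.exp_neg, ← div_eq_mul_inv, div_le_div_iff₀ (Real.exp_pos _) (by positivity)]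
    rw [div_le_iff₀ (by positivity)] at h4
    calc (τ⁻¹) ^ n * (a' / 2) ^ n = (a' / τ / 2) ^ n := by rw [← mul_pow]; congr 1; ring
      _ ≤ _ := h4
      _ = _ := mul_comm _ _
  calc (∏ w, t w ^ (-(mult w : ℝ) / 2)) * Real.exp (-(a' / τ) / 2)
      ≤ (ε⁻¹ * τ⁻¹) ^ n * Real.exp (-(a' / τ) / 2) :=
        mul_le_mul_of_nonneg_right h2 (Real.exp_pos _).le
    _ = (ε⁻¹) ^ n * ((τ⁻¹) ^ n * Real.exp (-(a' / τ) / 2)) := by rw [mul_pow]; ring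
    _ ≤ _ := mul_le_mul_of_nonneg_left h3 (by positivity)

lemma idealGauss_le_pow (J : (Ideal (𝓞 L))⁰) {ε : ℝ} (hε : 0 < ε) (N : ℕ) :
    ∃ C : ℝ, 0 ≤ C ∧ ∀ (τ : ℝ) (t : InfinitePlace L → ℝ), 1 ≤ τ → (∀ w, ε * τ ≤ t w) →
      idealGauss J t ≤ ENNReal.ofReal (C * (τ⁻¹) ^ N) := by
  obtain ⟨ι, _, e, c, B, hc, hB, he, hlow, hP⟩ := exists_ideal_poisson J
  have hpi := Real.pi_pos
  set a' := Real.pi * ε * c with ha'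
  have ha'0 : 0 < a' := by positivity
  set Z := ∑' k : ι → ℤ, Real.exp (-(a' / 2) * ∑ i, (k i : ℝ) ^ 2) with hZ
  have hZ0 : 0 ≤ Z := tsum_nonneg fun _ => (Real.exp_pos _).le
  refine ⟨(N.factorial / (a' / 2) ^ N) * Z, by positivity, fun τ t hτ ht => ?_⟩
  have hτ0 : 0 < τ := by positivity
  rw [idealGauss_eq e he]
  have h1 := tsum_ne_zero_exp_le (ι := ι) (f := fun k => Real.pi * placeForm t (e k))
    (a := a' * τ) (by positivity) (fun k => by
      have := hlow t (ε * τ) (by positivity) ht k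
      rw [ha']
      nlinarith) ha'0 (by nlinarith)
  simp only [neg_mul] at h1 hZ ⊢
  refine h1.trans (ENNReal.ofReal_le_ofReal ?_)
  rw [← hZ, mul_right_comm _ Z]
  refine mul_le_mul_of_nonneg_right ?_ hZ0
  have h4 := Real.pow_div_factorial_le_exp (x := a' * τ / 2) (by positivity) N
  rw [neg_div, Real.exp_neg, inv_pow, ← div_eq_mul_inv, div_div, inv_eq_one_div,
    div_le_div_iff₀ (Real.exp_pos _) (by positivity)]
  rw [div_le_iff₀ (by positivity)] at h4
  calc 1 * ((a' / 2) ^ N * τ ^ N) = (a' * τ / 2) ^ N := by rw [← mul_pow, one_mul]; congr 1; ring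
    _ ≤ _ := h4
    _ = _ := mul_comm _ _

end idealGauss

lemma tsum_tsum_subtype_eq {ι₁ ι₂ γ X : Type*} {c : ι₁ → γ} {val : ι₁ → ι₂ → X}
    {P : γ → X → Prop} (hmem : ∀ a b, P (c a) (val a b))
    (hinj : ∀ a b a' b', c a = c a' → val a b = val a' b' → a = a' ∧ b = b')
    (hsurj : ∀ C x, P C x → ∃ a b, c a = C ∧ val a b = x) (f : γ → X → ENNReal) :
    ∑' C, ∑' x : {x // P C x}, f C x = ∑' a, ∑' b, f (c a) (val a b) := by
  let Ψ : ι₁ × ι₂ → Σ C, {x // P C x} := fun p => ⟨c p.1, val p.1 p.2, hmem p.1 p.2⟩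
  have hbij : Function.Bijective Ψ := by
    constructor
    · intro p p' h
      obtain ⟨h1, h2⟩ := hinj p.1 p.2 p'.1 p'.2 (congrArg Sigma.fst h)
        (congrArg (fun x : Σ C, {x // P C x} => (x.2 : X)) h)
      exact Prod.ext h1 h2
    · rintro ⟨C, x, hx⟩
      obtain ⟨a, b, rfl, rfl⟩ := hsurj C x hx
      exact ⟨(a, b), rfl⟩
  calc ∑' C, ∑' x : {x // P C x}, f C x
      = ∑' x : Σ C, {x // P C x}, f x.1 x.2 :=
        (ENNReal.tsum_sigma' (fun x : Σ C, {x // P C x} => f x.1 x.2)).symm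
    _ = ∑' p, f (Ψ p).1 (Ψ p).2 :=
        ((Equiv.ofBijective Ψ hbij).tsum_eq fun x => f x.1 x.2).symm
    _ = _ := ENNReal.tsum_prod' (f := fun p => f (Ψ p).1 (Ψ p).2)

section classSum
variable {L : Type} [Field L] [NumberField L]

lemma exists_mul_principal {J : ClassGroup (𝓞 L) → (Ideal (𝓞 L))⁰}
    (hJ : ∀ C, ClassGroup.mk0 (J C) = C) (I : (Ideal (𝓞 L))⁰) :
    ∃ α : 𝓞 L, α ≠ 0 ∧ Ideal.span {α} =
      (I : Ideal (𝓞 L)) * J (ClassGroup.mk0 I)⁻¹ := by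
  have h1 : ClassGroup.mk0 (I * J (ClassGroup.mk0 I)⁻¹) = 1 := by
    rw [map_mul, hJ, mul_inv_cancel]
  rw [ClassGroup.mk0_eq_one_iff] at h1
  obtain ⟨α, hα⟩ := h1
  have hα' : Ideal.span {α} = (I : Ideal (𝓞 L)) * J (ClassGroup.mk0 I)⁻¹ := hα.symm
  refine ⟨α, ?_, hα'⟩
  rintro rfl
  have h2 := nonZeroDivisors.coe_ne_zero (I * J (ClassGroup.mk0 I)⁻¹)
  apply h2
  rw [Submonoid.coe_mul, ← hα']
  simp

section
variable {J : ClassGroup (𝓞 L) → (Ideal (𝓞 L))⁰} {g : (Ideal (𝓞 L))⁰ → 𝓞 L}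

lemma span_unit_mul_eq
    (hg : ∀ I, Ideal.span {g I} = (I : Ideal (𝓞 L)) * J (ClassGroup.mk0 I)⁻¹)
    (I : (Ideal (𝓞 L))⁰) (u : (𝓞 L)ˣ) :
    Ideal.span {(u : 𝓞 L) * g I} = (I : Ideal (𝓞 L)) * J (ClassGroup.mk0 I)⁻¹ := by
  rw [Ideal.span_singleton_mul_left_unit u.isUnit, hg]

lemma unit_mul_injective (hg0 : ∀ I, g I ≠ 0)
    (hg : ∀ I, Ideal.span {g I} = (I : Ideal (𝓞 L)) * J (ClassGroup.mk0 I)⁻¹)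
    {I I' : (Ideal (𝓞 L))⁰} {u u' : (𝓞 L)ˣ} (h1 : (ClassGroup.mk0 I)⁻¹ = (ClassGroup.mk0 I')⁻¹)
    (h2 : (u : 𝓞 L) * g I = u' * g I') : I = I' ∧ u = u' := by
  have h3 : (I : Ideal (𝓞 L)) * J (ClassGroup.mk0 I)⁻¹ = I' * J (ClassGroup.mk0 I)⁻¹ := by
    rw [← span_unit_mul_eq hg I u, h2, span_unit_mul_eq hg, h1]
  have h4 : I = I' :=
    Subtype.ext (mul_right_cancel₀ (nonZeroDivisors.coe_ne_zero _) h3)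
  subst h4
  exact ⟨rfl, Units.ext (mul_right_cancel₀ (hg0 I) h2)⟩

lemma exists_unit_mul_eq (hJ : ∀ C, ClassGroup.mk0 (J C) = C)
    (hg : ∀ I, Ideal.span {g I} = (I : Ideal (𝓞 L)) * J (ClassGroup.mk0 I)⁻¹)
    {C : ClassGroup (𝓞 L)} {α : 𝓞 L} (hα : α ∈ (J C : Ideal (𝓞 L))) (hα0 : α ≠ 0) :
    ∃ (I : (Ideal (𝓞 L))⁰) (u : (𝓞 L)ˣ), (ClassGroup.mk0 I)⁻¹ = C ∧ (u : 𝓞 L) * g I = α := by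
  obtain ⟨I, hI⟩ : (J C : Ideal (𝓞 L)) ∣ Ideal.span {α} := by
    rw [Ideal.dvd_span_singleton]; exact hα
  have hI0 : I ∈ (Ideal (𝓞 L))⁰ := by
    rw [mem_nonZeroDivisors_iff_ne_zero]
    rintro rfl
    rw [mul_zero, Ideal.zero_eq_bot, Ideal.span_singleton_eq_bot] at hI
    exact hα0 hI
  have hC : (ClassGroup.mk0 ⟨I, hI0⟩)⁻¹ = C := by
    have : ClassGroup.mk0 (J C * ⟨I, hI0⟩) = 1 := by
      rw [ClassGroup.mk0_eq_one_iff, Submonoid.coe_mul, ← hI]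
      exact ⟨α, rfl⟩
    rw [map_mul, hJ] at this
    exact (eq_inv_of_mul_eq_one_left this).symm
  have hspan' : Ideal.span {g ⟨I, hI0⟩} = Ideal.span {α} := by
    rw [hg, hC, hI, mul_comm]
  rw [Ideal.span_singleton_eq_span_singleton] at hspan'
  obtain ⟨u, hu⟩ := hspan'
  exact ⟨⟨I, hI0⟩, u, hC, by rw [← hu, mul_comm]⟩

end

/-- Reorganizing a sum over ideal classes and elements of representatives into a sum over ideals
and units. -/
lemma tsum_class_eq_tsum_ideal {J : ClassGroup (𝓞 L) → (Ideal (𝓞 L))⁰}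
    (hJ : ∀ C, ClassGroup.mk0 (J C) = C) :
    ∃ g : (Ideal (𝓞 L))⁰ → 𝓞 L, (∀ I, g I ≠ 0) ∧
      (∀ I, Ideal.span {g I} = (I : Ideal (𝓞 L)) * J (ClassGroup.mk0 I)⁻¹) ∧
      ∀ f : ClassGroup (𝓞 L) → 𝓞 L → ENNReal,
        ∑' C, ∑' α : {α : 𝓞 L // α ∈ (J C : Ideal (𝓞 L)) ∧ α ≠ 0}, f C α =
          ∑' I : (Ideal (𝓞 L))⁰, ∑' u : (𝓞 L)ˣ, f (ClassGroup.mk0 I)⁻¹ ((u : 𝓞 L) * g I) := by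
  have hex := exists_mul_principal hJ
  choose g hg0 hg using hex
  refine ⟨g, hg0, hg, fun f => ?_⟩
  have hmem : ∀ (I : (Ideal (𝓞 L))⁰) (u : (𝓞 L)ˣ),
      (u : 𝓞 L) * g I ∈ (J (ClassGroup.mk0 I)⁻¹ : Ideal (𝓞 L)) ∧ (u : 𝓞 L) * g I ≠ 0 := by
    refine fun I u => ⟨?_, mul_ne_zero u.ne_zero (hg0 _)⟩
    have h1 : Ideal.span {(u : 𝓞 L) * g I} ≤ (J (ClassGroup.mk0 I)⁻¹ : Ideal (𝓞 L)) :=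
      (span_unit_mul_eq hg I u).trans_le Ideal.mul_le_right
    exact (Ideal.span_singleton_le_iff_mem _).1 h1
  exact tsum_tsum_subtype_eq (c := fun I => (ClassGroup.mk0 I)⁻¹)
    (val := fun I (u : (𝓞 L)ˣ) => (u : 𝓞 L) * g I)
    (P := fun C α => α ∈ (J C : Ideal (𝓞 L)) ∧ α ≠ 0) hmem
    (fun I u I' u' h1 h2 => unit_mul_injective hg0 hg h1 h2)
    (fun C α hα => exists_unit_mul_eq hJ hg hα.1 hα.2) f

end classSum

section units
open NumberField.Units
variable {F L : Type} [Field F] [NumberField F] [Field L] [NumberField L] [Algebra F L]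

variable (F L) in
/-- The map of unit groups induced by an extension of number fields. -/
noncomputable def unitsMap : (𝓞 F)ˣ →* (𝓞 L)ˣ :=
  Units.map (algebraMap (𝓞 F) (𝓞 L)).toMonoidHom

omit [NumberField F] [NumberField L] in
lemma unitsMap_injective : Function.Injective (unitsMap F L) := by
  intro u v h
  have := congrArg (fun x : (𝓞 L)ˣ => (x : 𝓞 L)) h
  exact Units.ext (FaithfulSMul.algebraMap_injective (𝓞 F) (𝓞 L) this)

variable (F) in
/-- The unit with the given exponents in terms of the fundamental units. -/
noncomputable def fundPow (k : Fin (rank F) → ℤ) : (𝓞 F)ˣ := ∏ i, fundSystem F i ^ k i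

omit [NumberField L] in
/-- Decomposing a sum over the units of `L` according to the cosets of the units of `F`. -/
lemma exists_tsum_units_eq : ∃ ρ : ((𝓞 L)ˣ ⧸ (unitsMap F L).range) → (𝓞 L)ˣ,
    ∀ f : (𝓞 L)ˣ → ENNReal, ∑' u, f u =
      ∑' q, ∑' ζ : torsion F, ∑' k, f (ρ q * unitsMap F L (ζ * fundPow F k)) := by
  refine ⟨fun q => q.out, fun f => ?_⟩
  let e1 : torsion F × (Fin (rank F) → ℤ) ≃ (𝓞 F)ˣ :=
    Equiv.ofBijective (fun p => p.1 * fundPow F p.2) ⟨fun p p' h => by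
      obtain ⟨x, -, hx⟩ := exist_unique_eq_mul_prod F (p.1 * fundPow F p.2)
      exact (hx p rfl).trans (hx p' h).symm, fun u => by
      obtain ⟨x, hx, -⟩ := exist_unique_eq_mul_prod F u
      exact ⟨x, hx.symm⟩⟩
  have hbij : Function.Bijective
      fun p : ((𝓞 L)ˣ ⧸ (unitsMap F L).range) × (torsion F × (Fin (rank F) → ℤ)) =>
        p.1.out * unitsMap F L (p.2.1 * fundPow F p.2.2) := by
    constructor
    · rintro ⟨q, p⟩ ⟨q', p'⟩ h
      change q.out * unitsMap F L (e1 p) = q'.out * unitsMap F L (e1 p') at h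
      have hq : q = q' := by
        have := congrArg (fun u : (𝓞 L)ˣ => (u : (𝓞 L)ˣ ⧸ (unitsMap F L).range)) h
        rwa [QuotientGroup.mk_mul_of_mem _ (MonoidHom.mem_range.2 ⟨_, rfl⟩),
          QuotientGroup.mk_mul_of_mem _ (MonoidHom.mem_range.2 ⟨_, rfl⟩),
          QuotientGroup.out_eq', QuotientGroup.out_eq'] at this
      subst hq
      rw [e1.injective (unitsMap_injective (mul_left_cancel h))]
    · intro u
      have h1 : ((u : (𝓞 L)ˣ ⧸ (unitsMap F L).range).out)⁻¹ * u ∈ (unitsMap F L).range := by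
        rw [← QuotientGroup.eq, QuotientGroup.out_eq']
      obtain ⟨v, hv⟩ := h1
      obtain ⟨p, rfl⟩ := e1.surjective v
      refine ⟨(u, p), ?_⟩
      change _ * unitsMap F L (e1 p) = _
      rw [hv, mul_inv_cancel_left]
  rw [← (Equiv.ofBijective _ hbij).tsum_eq, ENNReal.tsum_prod']
  refine tsum_congr fun q => ?_
  rw [ENNReal.tsum_prod']
  rfl

end units

section lintegral

lemma lintegral_prod_eq_prod_ofReal {ι : Type*} [Fintype ι] {f : ι → ℝ → ℝ} {c : ι → ℝ}
    (hf : ∀ i x, 0 ≤ f i x) (hfm : ∀ i, Measurable (f i)) (hc : ∀ i, 0 ≤ c i)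
    (hfc : ∀ i, ∫⁻ x, ENNReal.ofReal (f i x) = ENNReal.ofReal (c i)) :
    ∫⁻ z : ι → ℝ, ENNReal.ofReal (∏ i, f i (z i)) = ENNReal.ofReal (∏ i, c i) := by
  have h_int : ∀ i, Integrable (f i) := fun i => by
    refine ⟨(hfm i).aestronglyMeasurable, ?_⟩
    rw [hasFiniteIntegral_iff_ofReal (Eventually.of_forall (hf i)), hfc]
    exact ENNReal.ofReal_lt_top
  have hval : ∀ i, ∫ x, f i x = c i := fun i => by
    rw [integral_eq_lintegral_of_nonneg_ae (Eventually.of_forall (hf i))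
      (hfm i).aestronglyMeasurable, hfc, ENNReal.toReal_ofReal (hc i)]
  have h := ofReal_integral_eq_lintegral_ofReal (Integrable.fintype_prod h_int)
    (Eventually.of_forall fun z => Finset.prod_nonneg fun i _ => hf i _)
  refine h.symm.trans ?_
  have h2 := integral_fintype_prod_volume_eq_prod f
  rw [volume_pi] at h2
  rw [h2]
  simp only [hval]

lemma lintegral_Ioi_eq_lintegral_exp (f : ℝ → ENNReal) :
    ∫⁻ y in Set.Ioi 0, f y = ∫⁻ x : ℝ, ENNReal.ofReal (Real.exp x) * f (Real.exp x) := by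
  have h := lintegral_image_eq_lintegral_abs_deriv_mul MeasurableSet.univ
    (fun x _ => (Real.hasDerivAt_exp x).hasDerivWithinAt) Real.exp_injective.injOn f
  rw [Set.image_univ, Real.range_exp] at h
  simpa [abs_of_pos (Real.exp_pos _)] using h

lemma lintegral_exp_mul_exp_neg {σ b : ℝ} (hσ : 0 < σ) (hb : 0 < b) :
    ∫⁻ z : ℝ, ENNReal.ofReal (Real.exp (z * σ) * Real.exp (-(b * Real.exp z))) =
      ENNReal.ofReal ((1 / b) ^ σ * Real.Gamma σ) := by
  have h1 := Real.integral_rpow_mul_exp_neg_mul_Ioi hσ hb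
  have h_int : IntegrableOn (fun t : ℝ => t ^ (σ - 1) * Real.exp (-(b * t))) (Set.Ioi 0) := by
    by_contra h
    rw [integral_undef h] at h1
    have : 0 < (1 / b) ^ σ * Real.Gamma σ :=
      mul_pos (Real.rpow_pos_of_pos (by positivity) _) (Real.Gamma_pos_of_pos hσ)
    exact this.ne h1
  rw [← h1, ofReal_integral_eq_lintegral_ofReal h_int, lintegral_Ioi_eq_lintegral_exp]
  · refine lintegral_congr fun z => ?_
    rw [← ENNReal.ofReal_mul (Real.exp_pos _).le, ← Real.exp_mul, ← mul_assoc, ← Real.exp_add z,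
      show z + z * (σ - 1) = z * σ by ring]
  · filter_upwards [self_mem_ae_restrict measurableSet_Ioi] with t ht
    have : (0 : ℝ) < t := ht
    positivity

/-- Linear change of variables from `ℝ × ℝʳ`. -/
lemma exists_lintegral_prod_eq {ι V : Type*} [Fintype ι] [Fintype V]
    (hcard : Fintype.card V = Fintype.card ι + 1) (T : (ℝ × (ι → ℝ)) →ₗ[ℝ] (V → ℝ))
    (hT : Function.Injective T) :
    ∃ κ : NNReal, κ ≠ 0 ∧ ∀ h : (V → ℝ) → ENNReal,
      ∫⁻ p, h (T p) = κ * ∫⁻ v, h v := by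
  have hfin : Module.finrank ℝ (ℝ × (ι → ℝ)) = Module.finrank ℝ (V → ℝ) := by
    simp [hcard, add_comm]
  let E : (ℝ × (ι → ℝ)) ≃L[ℝ] (V → ℝ) :=
    (LinearEquiv.ofInjectiveOfFinrankEq T hT hfin).toContinuousLinearEquiv
  have hE : ∀ p, E p = T p := fun p => rfl
  have : (volume : Measure (ℝ × (ι → ℝ))).IsAddHaarMeasure :=
    inferInstanceAs ((volume : Measure ℝ).prod (volume : Measure (ι → ℝ))).IsAddHaarMeasure
  have : (volume : Measure (ℝ × (ι → ℝ))).IsAddHaarMeasure :=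
    inferInstanceAs ((volume : Measure ℝ).prod (volume : Measure (ι → ℝ))).IsAddHaarMeasure
  have hH : Measure.IsAddHaarMeasure ((volume : Measure (ℝ × (ι → ℝ))).map E) :=
    E.isAddHaarMeasure_map volume
  have hmap := Measure.isAddLeftInvariant_eq_smul
    ((volume : Measure (ℝ × (ι → ℝ))).map E) (volume : Measure (V → ℝ))
  refine ⟨_, (Measure.addHaarScalarFactor_pos_of_isAddHaarMeasure
    ((volume : Measure (ℝ × (ι → ℝ))).map E) (volume : Measure (V → ℝ))).ne', fun h => ?_⟩
  have h1 : ∫⁻ x, h x ∂((volume : Measure (ℝ × (ι → ℝ))).map E) = ∫⁻ p, h (E p) :=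
    E.toHomeomorph.measurableEmbedding.lintegral_map _
  rw [hmap, lintegral_smul_measure] at h1
  simp only [← hE, ← h1, ENNReal.smul_def, smul_eq_mul]

end lintegral

section unitDirections
open NumberField.Units
variable (F : Type) [Field F] [NumberField F]

/-- The linear map `(x, c) ↦ (x / n + ∑ i, 2 c i log (v ε i))_v`, with `ε i` the fundamental
units. -/
noncomputable def unitDirections :
    (ℝ × (Fin (rank F) → ℝ)) →ₗ[ℝ] (InfinitePlace F → ℝ) where
  toFun p v := p.1 / Fintype.card (InfinitePlace F) +
    ∑ i, p.2 i * (2 * Real.log (v (fundSystem F i : F)))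
  map_add' p q := by
    ext v
    simp only [Prod.fst_add, Prod.snd_add, Pi.add_apply, add_mul, Finset.sum_add_distrib]
    ring
  map_smul' a p := by
    ext v
    simp only [Prod.smul_fst, Prod.smul_snd, Pi.smul_apply, smul_eq_mul, RingHom.id_apply,
      mul_add, Finset.mul_sum, mul_assoc]
    ring

variable {F}

lemma unitDirections_apply (p : ℝ × (Fin (rank F) → ℝ)) (v : InfinitePlace F) :
    unitDirections F p v = p.1 / Fintype.card (InfinitePlace F) +
      ∑ i, p.2 i * (2 * Real.log (v (fundSystem F i : F))) := rfl

lemma sum_log_unit_eq_zero (hF : ∀ v : InfinitePlace F, v.IsReal) (u : (𝓞 F)ˣ) :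
    ∑ v : InfinitePlace F, Real.log (v (u : F)) = 0 := by
  rw [← sum_mult_mul_log u]
  refine Finset.sum_congr rfl fun v _ => ?_
  simp [InfinitePlace.mult_isReal ⟨v, hF v⟩]

lemma sum_unitDirections (hF : ∀ v : InfinitePlace F, v.IsReal)
    (p : ℝ × (Fin (rank F) → ℝ)) : ∑ v, unitDirections F p v = p.1 := by
  simp only [unitDirections_apply, Finset.sum_add_distrib]
  rw [Finset.sum_comm]
  simp only [← Finset.mul_sum, sum_log_unit_eq_zero hF]
  have : (Fintype.card (InfinitePlace F) : ℝ) ≠ 0 := by simp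
  simp only [Finset.sum_const, Finset.card_univ, nsmul_eq_mul, mul_zero, add_zero]
  field_simp

lemma unitDirections_injective (hF : ∀ v : InfinitePlace F, v.IsReal) :
    Function.Injective (unitDirections F) := by
  rw [← LinearMap.ker_eq_bot, LinearMap.ker_eq_bot']
  rintro ⟨x, c⟩ h
  have hx : x = 0 := by
    have := sum_unitDirections hF (x, c)
    rw [h] at this
    simpa using this.symm
  subst hx
  have hli := isMaxRank_fundSystem F
  rw [IsMaxRank, Fintype.linearIndependent_iff] at hli
  have hc : ∀ i, c i = 0 := by
    refine hli c ?_
    ext v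
    have hv := congrFun h v.1
    rw [unitDirections_apply] at hv
    simp only [zero_div, zero_add, Pi.zero_apply] at hv
    simp only [Finset.sum_apply, Pi.smul_apply, smul_eq_mul,
      Pi.zero_apply, dirichletUnitTheorem.logEmbedding_component,
      InfinitePlace.mult_isReal ⟨v.1, hF v.1⟩, Nat.cast_one, one_mul]
    rw [← mul_right_inj' (two_ne_zero (α := ℝ)), mul_zero, ← hv, Finset.mul_sum]
    exact Finset.sum_congr rfl fun i _ => by ring
  ext i
  · rfl
  · exact hc i

lemma exists_lintegral_unitDirections (hF : ∀ v : InfinitePlace F, v.IsReal) :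
    ∃ κ : NNReal, κ ≠ 0 ∧ ∀ h : (InfinitePlace F → ℝ) → ENNReal,
      ∫⁻ p, h (unitDirections F p) = κ * ∫⁻ v, h v := by
  refine exists_lintegral_prod_eq ?_ _ (unitDirections_injective hF)
  have : 0 < Fintype.card (InfinitePlace F) := Fintype.card_pos
  rw [Fintype.card_fin, rank]
  omega

end unitDirections

/-- An extension of a totally real field `F` whose infinite places correspond to those of `F` and
all have the same multiplicity `m`. -/
structure PlaceTower (F L : Type) [Field F] [NumberField F] [Field L] [NumberField L]
    [Algebra F L] where
  /-- The correspondence between infinite places. -/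
  e : InfinitePlace F ≃ InfinitePlace L
  /-- The common multiplicity of the infinite places of `L`. -/
  m : ℕ
  e_apply : ∀ v x, e v (algebraMap F L x) = v x
  mult_eq : ∀ w : InfinitePlace L, w.mult = m
  isReal : ∀ v : InfinitePlace F, v.IsReal

namespace PlaceTower
open NumberField.Units
variable {F L : Type} [Field F] [NumberField F] [Field L] [NumberField L] [Algebra F L]

lemma card_pos : (0 : ℝ) < Fintype.card (InfinitePlace F) := by
  exact_mod_cast Fintype.card_pos

variable (T : PlaceTower F L)

lemma m_pos : (0 : ℝ) < T.m := by
  obtain ⟨w⟩ : Nonempty (InfinitePlace L) := inferInstance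
  rw [← T.mult_eq w]
  exact_mod_cast InfinitePlace.mult_pos

/-- The scaling parameters at the infinite places of `L`. -/
noncomputable def tvec (J : (Ideal (𝓞 L))⁰) (y : ℝ) (c : Fin (rank F) → ℝ) :
    InfinitePlace L → ℝ := fun w =>
  (Ideal.absNorm (J : Ideal (𝓞 L)) : ℝ) ^ (-2 / (T.m * Fintype.card (InfinitePlace F)) : ℝ) *
    (y ^ (1 / Fintype.card (InfinitePlace F) : ℝ) *
      Real.exp (∑ i, c i * (2 * Real.log (T.e.symm w (fundSystem F i : F)))))

lemma absNorm_pos (J : (Ideal (𝓞 L))⁰) : (0 : ℝ) < Ideal.absNorm (J : Ideal (𝓞 L)) := by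
  exact_mod_cast Ideal.absNorm_pos_of_nonZeroDivisors J

lemma tvec_pos (J : (Ideal (𝓞 L))⁰) {y : ℝ} (hy : 0 < y) (c : Fin (rank F) → ℝ)
    (w : InfinitePlace L) : 0 < T.tvec J y c w := by
  have := absNorm_pos J
  unfold tvec
  positivity

lemma tvec_exp (J : (Ideal (𝓞 L))⁰) (x : ℝ) (c : Fin (rank F) → ℝ) (v : InfinitePlace F) :
    T.tvec J (Real.exp x) c (T.e v) =
      (Ideal.absNorm (J : Ideal (𝓞 L)) : ℝ) ^
        (-2 / (T.m * Fintype.card (InfinitePlace F)) : ℝ) *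
      Real.exp (unitDirections F (x, c) v) := by
  rw [tvec, unitDirections_apply, Real.exp_add, ← Real.exp_mul, Equiv.symm_apply_apply]
  simp only [div_eq_mul_inv, one_mul]

lemma place_unitsMap_fundPow (k : Fin (rank F) → ℤ) (v : InfinitePlace F) :
    T.e v ((unitsMap F L (fundPow F k) : 𝓞 L) : L) =
      Real.exp (∑ i, k i * Real.log (v (fundSystem F i : F))) := by
  have h1 : (((unitsMap F L (fundPow F k) : (𝓞 L)ˣ) : 𝓞 L) : L) =
      algebraMap F L ((fundPow F k : 𝓞 F) : F) := rfl
  have h2 : ((fundPow F k : 𝓞 F) : F) = ∏ i, ((fundSystem F i : 𝓞 F) : F) ^ k i := by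
    simp only [fundPow, Units.coe_prod, map_prod]
    exact Finset.prod_congr rfl fun i _ => NumberField.Units.coe_zpow _ _
  rw [h1, T.e_apply, h2, map_prod, Real.exp_sum]
  refine Finset.prod_congr rfl fun i _ => ?_
  have hpos : 0 < v ((fundSystem F i : 𝓞 F) : F) := pos_at_place _ _
  rw [map_zpow₀, mul_comm, Real.exp_mul, Real.exp_log hpos, Real.rpow_intCast]

lemma tvec_add_intVec (J : (Ideal (𝓞 L))⁰) (y : ℝ) (c : Fin (rank F) → ℝ)
    (k : Fin (rank F) → ℤ) (w : InfinitePlace L) :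
    T.tvec J y (c + intVec k) w =
      T.tvec J y c w * w ((unitsMap F L (fundPow F k) : 𝓞 L) : L) ^ 2 := by
  obtain ⟨v, rfl⟩ := T.e.surjective w
  rw [place_unitsMap_fundPow, tvec, tvec, Equiv.symm_apply_apply, mul_assoc, mul_assoc,
    ← Real.exp_nat_mul, ← Real.exp_add, Finset.mul_sum, ← Finset.sum_add_distrib]
  congr 3
  refine Finset.sum_congr rfl fun i _ => ?_
  simp only [intVec, Pi.add_apply]
  push_cast
  ring

omit [NumberField F] in
lemma place_torsion (ζ : torsion F) (w : InfinitePlace L) :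
    w ((unitsMap F L ζ : 𝓞 L) : L) = 1 := by
  have h := (CommGroup.mem_torsion _).1 ζ.2
  have h' : IsOfFinOrder (unitsMap F L ζ) := (unitsMap F L).isOfFinOrder h
  rw [← CommGroup.mem_torsion] at h'
  exact (mem_torsion L).1 h' w

lemma placeForm_tvec_unit_mul (J : (Ideal (𝓞 L))⁰) (y : ℝ) (c : Fin (rank F) → ℝ)
    (ζ : torsion F) (k : Fin (rank F) → ℤ) (α : 𝓞 L) :
    placeForm (T.tvec J y c) (unitsMap F L (ζ * fundPow F k) * α) =
      placeForm (T.tvec J y (c + intVec k)) α := by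
  refine Finset.sum_congr rfl fun w _ => ?_
  have h : w (((unitsMap F L (ζ * fundPow F k) : 𝓞 L) * α : 𝓞 L) : L) =
      w ((unitsMap F L ζ : 𝓞 L) : L) * w ((unitsMap F L (fundPow F k) : 𝓞 L) : L) *
        w (α : L) := by
    rw [map_mul (unitsMap F L), ← map_mul w, ← map_mul w]
    rfl
  rw [tvec_add_intVec, h, place_torsion]
  ring

/-- The Gaussian term attached to `α`. -/
noncomputable def gaussTerm (J : (Ideal (𝓞 L))⁰) (α : 𝓞 L) (σ : ℝ)
    (p : ℝ × (Fin (rank F) → ℝ)) : ENNReal :=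
  ENNReal.ofReal (Real.exp (-Real.pi * placeForm (T.tvec J p.1 p.2) α)) *
    ENNReal.ofReal (p.1 ^ (σ - 1))

lemma measurable_tvec (J : (Ideal (𝓞 L))⁰) (w : InfinitePlace L) :
    Measurable fun p : ℝ × (Fin (rank F) → ℝ) => T.tvec J p.1 p.2 w := by
  unfold tvec
  fun_prop

lemma measurable_gaussTerm (J : (Ideal (𝓞 L))⁰) (α : 𝓞 L) (σ : ℝ) :
    Measurable (T.gaussTerm J α σ) := by
  have := T.measurable_tvec J
  unfold gaussTerm placeForm
  fun_prop

/-- The archimedean factor of the completed zeta function. -/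
noncomputable def gammaFactor (s : ℝ) : ℝ :=
  (Real.pi ^ (-(T.m * s / 2)) * Real.Gamma (T.m * s / 2)) ^ Fintype.card (InfinitePlace F)

lemma prod_place_pow {I J : (Ideal (𝓞 L))⁰} {α : 𝓞 L}
    (hα : Ideal.span {α} = (I : Ideal (𝓞 L)) * J) :
    (∏ v, T.e v (α : L)) ^ T.m =
      (Ideal.absNorm (I : Ideal (𝓞 L)) : ℝ) * Ideal.absNorm (J : Ideal (𝓞 L)) := by
  have h1 := InfinitePlace.prod_eq_abs_norm (α : L)
  simp only [T.mult_eq] at h1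
  rw [Equiv.prod_comp T.e fun w => w (α : L), ← Finset.prod_pow, h1, ← Nat.cast_mul, ← map_mul,
    ← hα, Ideal.absNorm_span_singleton, ← Algebra.coe_norm_int]
  push_cast
  simp [Nat.cast_natAbs]

lemma lintegral_gaussTerm {κ : NNReal}
    (hκ : ∀ h : (InfinitePlace F → ℝ) → ENNReal,
      ∫⁻ p, h (unitDirections F p) = κ * ∫⁻ v, h v)
    {I J : (Ideal (𝓞 L))⁰} {α : 𝓞 L} (hα : Ideal.span {α} = (I : Ideal (𝓞 L)) * J)
    {s : ℝ} (hs : 0 < s) :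
    ∫⁻ y in Set.Ioi 0, ∫⁻ c, T.gaussTerm J α (T.m * s / 2) (y, c) =
      κ * ENNReal.ofReal (T.gammaFactor s *
        (Ideal.absNorm (I : Ideal (𝓞 L)) : ℝ) ^ (-s)) := by
  set σ := T.m * s / 2 with hσ
  have hm := T.m_pos
  have hσ0 : 0 < σ := by positivity
  set n := Fintype.card (InfinitePlace F)
  have hn : (0 : ℝ) < n := card_pos
  have hI := absNorm_pos I
  have hJ := absNorm_pos J
  set A := (Ideal.absNorm (J : Ideal (𝓞 L)) : ℝ) ^ (-2 / (T.m * n) : ℝ) with hA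
  have hA0 : 0 < A := by positivity
  have hprod := T.prod_place_pow hα
  have hα0 : α ≠ 0 := by
    rintro rfl
    have hm' : T.m ≠ 0 := by exact_mod_cast hm.ne'
    simp only [map_zero, Finset.prod_const, Finset.card_univ,
      zero_pow (Fintype.card_ne_zero (α := InfinitePlace F)), zero_pow hm'] at hprod
    exact (mul_pos hI hJ).ne hprod
  have hx : ∀ v, 0 < T.e v (α : L) := fun v => InfinitePlace.pos_iff.2 (by simpa using hα0)
  let b : InfinitePlace F → ℝ := fun v => Real.pi * (A * T.e v (α : L) ^ 2)
  have hb : ∀ v, 0 < b v := fun v => by have := hx v; positivity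
  rw [lintegral_Ioi_eq_lintegral_exp]
  have hmeas : Measurable fun p : ℝ × (Fin (rank F) → ℝ) =>
      ENNReal.ofReal (Real.exp p.1) * T.gaussTerm J α σ (Real.exp p.1, p.2) := by
    have := T.measurable_gaussTerm J α σ
    fun_prop
  have h1 : ∀ p, ENNReal.ofReal (Real.exp p.1) * T.gaussTerm J α σ (Real.exp p.1, p.2) =
      ENNReal.ofReal (∏ v, (Real.exp (unitDirections F p v * σ) *
        Real.exp (-(b v * Real.exp (unitDirections F p v))))) := by
    intro p
    rw [gaussTerm, ← ENNReal.ofReal_mul (Real.exp_pos _).le,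
      ← ENNReal.ofReal_mul (Real.exp_pos _).le]
    congr 1
    rw [Finset.prod_mul_distrib, ← Real.exp_sum, ← Real.exp_sum, ← Finset.sum_mul,
      sum_unitDirections T.isReal, placeForm, ← Equiv.sum_comp T.e, Finset.mul_sum,
      ← Real.exp_mul, mul_left_comm, ← Real.exp_add, mul_comm,
      show p.1 + p.1 * (σ - 1) = p.1 * σ by ring]
    congr 2
    refine Finset.sum_congr rfl fun v _ => ?_
    rw [T.tvec_exp J p.1 p.2 v]
    simp only [b, hA, n]
    ring
  calc ∫⁻ x : ℝ, ENNReal.ofReal (Real.exp x) * ∫⁻ c, T.gaussTerm J α σ (Real.exp x, c)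
      = ∫⁻ x : ℝ, ∫⁻ c, ENNReal.ofReal (Real.exp x) * T.gaussTerm J α σ (Real.exp x, c) := by
        refine lintegral_congr fun x => ?_
        rw [lintegral_const_mul]
        exact (T.measurable_gaussTerm J α σ).comp (measurable_const.prodMk measurable_id)
    _ = ∫⁻ p : ℝ × (Fin (rank F) → ℝ),
          ENNReal.ofReal (Real.exp p.1) * T.gaussTerm J α σ (Real.exp p.1, p.2) :=
        (lintegral_prod _ hmeas.aemeasurable).symm
    _ = κ * ∫⁻ z : InfinitePlace F → ℝ, ENNReal.ofReal (∏ v, (Real.exp (z v * σ) *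
          Real.exp (-(b v * Real.exp (z v))))) := by
        rw [← hκ]
        exact lintegral_congr h1
    _ = _ := ?_
  congr 1
  rw [lintegral_prod_eq_prod_ofReal (c := fun v => (1 / b v) ^ σ * Real.Gamma σ)
    (f := fun v z => Real.exp (z * σ) * Real.exp (-(b v * Real.exp z)))
    (fun v z => by positivity) (fun v => by fun_prop)
    (fun v => mul_nonneg (Real.rpow_nonneg (by have := hb v; positivity) _)
      (Real.Gamma_pos_of_pos hσ0).le) fun v => lintegral_exp_mul_exp_neg hσ0 (hb v)]
  congr 1
  have h2 : ∀ v, (1 / b v) ^ σ * Real.Gamma σ =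
      Real.pi ^ (-σ) * Real.Gamma σ * A ^ (-σ) * (T.e v (α : L)) ^ (-(T.m * s)) := by
    intro v
    have := hx v
    rw [one_div, Real.inv_rpow (hb v).le, ← Real.rpow_neg (hb v).le,
      Real.mul_rpow Real.pi_pos.le (by positivity), Real.mul_rpow hA0.le (by positivity),
      ← Real.rpow_natCast, ← Real.rpow_mul this.le,
      show ((2 : ℕ) : ℝ) * -σ = -(T.m * s) by rw [hσ]; push_cast; ring]
    ring
  rw [Finset.prod_congr rfl fun v _ => h2 v, Finset.prod_mul_distrib, Finset.prod_mul_distrib,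
    Finset.prod_const, Finset.prod_const, Real.finsetProd_rpow _ _ fun v _ => (hx v).le,
    neg_mul_eq_mul_neg, Real.rpow_mul (Finset.prod_nonneg fun v _ => (hx v).le),
    Real.rpow_natCast, hprod, hA, ← Real.rpow_mul hJ.le, ← Real.rpow_natCast (_ ^ _),
    ← Real.rpow_mul hJ.le, Real.mul_rpow hI.le hJ.le, gammaFactor, Finset.card_univ,
    show (-2 / (T.m * n) * -σ * (n : ℕ) : ℝ) = s by rw [hσ]; field_simp, Real.rpow_neg hJ.le]
  have := (Real.rpow_pos_of_pos hJ s).ne'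
  rw [← hσ]
  change _ = (_ * Real.Gamma σ) ^ n * _
  generalize Real.Gamma σ = g
  field_simp
  rfl

end PlaceTower

lemma lintegral_mul_eq_tsum {Ω ι : Type*} [MeasurableSpace Ω] [Countable ι] (μ : Measure Ω)
    {f : Ω → ENNReal} (hf : Measurable f) {b : ENNReal} {g : ι → Ω → ENNReal}
    (hg : ∀ i, Measurable (g i)) (h : ∀ c, f c * b = ∑' i, g i c) :
    (∫⁻ c, f c ∂μ) * b = ∑' i, ∫⁻ c, g i c ∂μ := by
  rw [← lintegral_mul_const _ hf, ← lintegral_tsum fun i => (hg i).aemeasurable]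
  exact lintegral_congr h

namespace PlaceTower
open NumberField.Units
variable {F L : Type} [Field F] [NumberField F] [Field L] [NumberField L] [Algebra F L]
variable (T : PlaceTower F L)

/-- The theta function attached to representatives of the ideal classes, averaged over unit
directions. -/
noncomputable def thetaInt (J : ClassGroup (𝓞 L) → (Ideal (𝓞 L))⁰) (y : ℝ) : ENNReal :=
  ∑' C, ∫⁻ c in unitCube (Fin (rank F)), idealGauss (J C) (T.tvec (J C) y c)

instance instCountableRingOfIntegers : Countable (𝓞 L) := by
  have : Countable (Fin (Module.finrank ℤ (𝓞 L)) → ℤ) := inferInstance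
  exact (Module.finBasis ℤ (𝓞 L)).equivFun.injective.countable

lemma measurable_idealGauss_tvec (J : (Ideal (𝓞 L))⁰) :
    Measurable fun p : ℝ × (Fin (rank F) → ℝ) => idealGauss J (T.tvec J p.1 p.2) := by
  have := T.measurable_tvec J
  unfold idealGauss placeForm
  fun_prop

lemma measurable_thetaInt (J : ClassGroup (𝓞 L) → (Ideal (𝓞 L))⁰) :
    Measurable (T.thetaInt J) := by
  have h : ∀ C, Measurable fun y =>
      ∫⁻ c in unitCube (Fin (rank F)), idealGauss (J C) (T.tvec (J C) y c) := fun C =>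
    (T.measurable_idealGauss_tvec (J C)).lintegral_prod_right'
  unfold thetaInt
  fun_prop

lemma measurable_lintegral_gaussTerm (J : (Ideal (𝓞 L))⁰) (α : 𝓞 L) (σ : ℝ) :
    Measurable fun y => ∫⁻ c in unitCube (Fin (rank F)), T.gaussTerm J α σ (y, c) :=
  (T.measurable_gaussTerm J α σ).lintegral_prod_right'

lemma idealGauss_mul_rpow (J : (Ideal (𝓞 L))⁰) (σ y : ℝ) (c : Fin (rank F) → ℝ) :
    idealGauss J (T.tvec J y c) * ENNReal.ofReal (y ^ (σ - 1)) =
      ∑' α : {α : 𝓞 L // α ∈ (J : Ideal (𝓞 L)) ∧ α ≠ 0}, T.gaussTerm J α σ (y, c) :=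
  ENNReal.tsum_mul_right.symm

lemma measurable_idealGauss_tvec_right (J : (Ideal (𝓞 L))⁰) (y : ℝ) :
    Measurable fun c : Fin (rank F) → ℝ => idealGauss J (T.tvec J y c) :=
  Measurable.of_uncurry_left (f := fun y c => idealGauss J (T.tvec J y c))
    (T.measurable_idealGauss_tvec J)

lemma measurable_gaussTerm_right (J : (Ideal (𝓞 L))⁰) (α : 𝓞 L) (σ y : ℝ) :
    Measurable fun c => T.gaussTerm J α σ (y, c) :=
  Measurable.of_uncurry_left (f := fun y c => T.gaussTerm J α σ (y, c))
    (T.measurable_gaussTerm J α σ)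

lemma lintegral_idealGauss_mul_rpow (J : (Ideal (𝓞 L))⁰) (σ y : ℝ) :
    (∫⁻ c in unitCube (Fin (rank F)), idealGauss J (T.tvec J y c)) *
        ENNReal.ofReal (y ^ (σ - 1)) =
      ∑' α : {α : 𝓞 L // α ∈ (J : Ideal (𝓞 L)) ∧ α ≠ 0},
        ∫⁻ c in unitCube (Fin (rank F)), T.gaussTerm J α σ (y, c) :=
  lintegral_mul_eq_tsum _ (T.measurable_idealGauss_tvec_right J y)
    (fun α => T.measurable_gaussTerm_right J α σ y) (T.idealGauss_mul_rpow J σ y)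

lemma lintegral_thetaInt_mul_rpow (J : ClassGroup (𝓞 L) → (Ideal (𝓞 L))⁰) (σ : ℝ) :
    ∫⁻ y in Set.Ioi 0, T.thetaInt J y * ENNReal.ofReal (y ^ (σ - 1)) =
      ∑' C, ∑' α : {α : 𝓞 L // α ∈ (J C : Ideal (𝓞 L)) ∧ α ≠ 0},
        ∫⁻ y in Set.Ioi 0, ∫⁻ c in unitCube (Fin (rank F)), T.gaussTerm (J C) α σ (y, c) := by
  have h := T.measurable_lintegral_gaussTerm
  simp only [thetaInt, ← ENNReal.tsum_mul_right, lintegral_idealGauss_mul_rpow]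
  rw [lintegral_tsum fun C => (Measurable.tsum fun α => h _ _ _).aemeasurable]
  exact tsum_congr fun C => lintegral_tsum fun α => (h _ _ _).aemeasurable

lemma tsum_lintegral_gaussTerm_fundPow (J : (Ideal (𝓞 L))⁰) (ζ : torsion F) (α : 𝓞 L) (σ : ℝ) :
    ∑' k, ∫⁻ y in Set.Ioi 0, ∫⁻ c in unitCube (Fin (rank F)),
        T.gaussTerm J (unitsMap F L (ζ * fundPow F k) * α) σ (y, c) =
      ∫⁻ y in Set.Ioi 0, ∫⁻ c, T.gaussTerm J α σ (y, c) := by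
  rw [← lintegral_tsum fun k => (T.measurable_lintegral_gaussTerm J _ σ).aemeasurable]
  refine lintegral_congr fun y => ?_
  rw [← tsum_lintegral_unitCube_add fun c => T.gaussTerm J α σ (y, c)]
  simp only [gaussTerm, placeForm_tvec_unit_mul]

variable (F) in
lemma exists_lintegral_thetaInt (hF : ∀ v : InfinitePlace F, v.IsReal) :
    ∃ κ : NNReal, κ ≠ 0 ∧ ∀ {L : Type} [Field L] [NumberField L] [Algebra F L]
      (T : PlaceTower F L) {J : ClassGroup (𝓞 L) → (Ideal (𝓞 L))⁰}
      (_ : ∀ C, ClassGroup.mk0 (J C) = C) {s : ℝ} (_ : 0 < s),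
      ∫⁻ y in Set.Ioi 0, T.thetaInt J y * ENNReal.ofReal (y ^ (T.m * s / 2 - 1)) =
        ENat.card ((𝓞 L)ˣ ⧸ (unitsMap F L).range) * (κ * ENNReal.ofReal (T.gammaFactor s) *
          ∑' I : (Ideal (𝓞 L))⁰,
            ENNReal.ofReal ((Ideal.absNorm (I : Ideal (𝓞 L)) : ℝ) ^ (-s))) := by
  obtain ⟨κ, hκ0, hκ⟩ := exists_lintegral_unitDirections hF
  refine ⟨Nat.card (torsion F) * κ, mul_ne_zero (by exact_mod_cast torsionOrder_ne_zero F) hκ0, ?_⟩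
  intro L _ _ _ T J hJ s hs
  obtain ⟨g, -, hg, hgsum⟩ := tsum_class_eq_tsum_ideal hJ
  obtain ⟨ρ, hρ⟩ := exists_tsum_units_eq (F := F) (L := L)
  have key : ∀ (I : (Ideal (𝓞 L))⁰) q (ζ : torsion F),
      ∑' k, ∫⁻ y in Set.Ioi 0, ∫⁻ c in unitCube (Fin (rank F)),
        T.gaussTerm (J (ClassGroup.mk0 I)⁻¹)
          ((ρ q * unitsMap F L (ζ * fundPow F k) : (𝓞 L)ˣ) * g I) (T.m * s / 2) (y, c) =
      κ * ENNReal.ofReal (T.gammaFactor s *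
        (Ideal.absNorm (I : Ideal (𝓞 L)) : ℝ) ^ (-s)) := by
    intro I q ζ
    rw [← T.lintegral_gaussTerm hκ (α := ρ q * g I) (J := J (ClassGroup.mk0 I)⁻¹)
      (span_unit_mul_eq hg I _) hs, ← T.tsum_lintegral_gaussTerm_fundPow _ ζ]
    refine tsum_congr fun k => ?_
    rw [Units.val_mul, mul_comm (ρ q : 𝓞 L), mul_assoc]
  have hG : 0 ≤ T.gammaFactor s := by
    have := T.m_pos
    exact pow_nonneg (mul_nonneg (by positivity)
      (Real.Gamma_pos_of_pos (by positivity)).le) _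
  rw [lintegral_thetaInt_mul_rpow, hgsum fun C α => ∫⁻ y in Set.Ioi 0,
    ∫⁻ c in unitCube (Fin (rank F)), T.gaussTerm (J C) α (T.m * s / 2) (y, c)]
  simp only [hρ, key, ENNReal.ofReal_mul hG, ENNReal.tsum_mul_left, ENNReal.tsum_const]
  simp only [ENat.card_eq_coe_natCard]
  push_cast
  ring

end PlaceTower

namespace PlaceTower
open NumberField.Units NumberField.InfinitePlace
variable {F L : Type} [Field F] [NumberField F] [Field L] [NumberField L] [Algebra F L]

variable (L) in
/-- The inverse of the covolume of the ring of integers. -/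
noncomputable def gaussCoef : ℝ := ((2⁻¹ : ℝ) ^ nrComplexPlaces L * √|discr L|)⁻¹

variable (L) in
lemma gaussCoef_pos : 0 < gaussCoef L := by
  have h2 : (0 : ℝ) < |(discr L : ℝ)| := abs_pos.2 (by exact_mod_cast discr_ne_zero L)
  exact inv_pos.2 (mul_pos (by positivity) (Real.sqrt_pos.2 h2))

variable (T : PlaceTower F L)

lemma prod_tvec (J : (Ideal (𝓞 L))⁰) {y : ℝ} (hy : 0 < y) (c : Fin (rank F) → ℝ) :
    ∏ w, T.tvec J y c w = (Ideal.absNorm (J : Ideal (𝓞 L)) : ℝ) ^ (-2 / T.m : ℝ) * y := by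
  have hN := absNorm_pos J
  have hc := card_pos (F := F)
  have hm := T.m_pos
  rw [← Real.exp_log hy, ← T.e.prod_comp]
  simp only [tvec_exp, Finset.prod_mul_distrib, ← Real.exp_sum, sum_unitDirections T.isReal,
    Finset.prod_const, Finset.card_univ]
  rw [← Real.rpow_natCast, ← Real.rpow_mul hN.le]
  congr 2
  field_simp

lemma idealGaussMain_tvec (J : (Ideal (𝓞 L))⁰) {y : ℝ} (hy : 0 < y) (c : Fin (rank F) → ℝ) :
    idealGaussMain J (T.tvec J y c) = gaussCoef L * y ^ (-(T.m : ℝ) / 2) := by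
  have hN := absNorm_pos J
  have hm := T.m_pos
  rw [idealGaussMain, idealCovolume, gaussCoef]
  simp only [T.mult_eq]
  rw [Real.finsetProd_rpow _ _ (fun w _ => (T.tvec_pos J hy c w).le), prod_tvec _ _ hy,
    Real.mul_rpow (by positivity) hy.le, ← Real.rpow_mul hN.le,
    show (-2 / T.m : ℝ) * (-T.m / 2) = 1 by field_simp, Real.rpow_one, mul_assoc _ _ (√_),
    mul_div_mul_left _ _ hN.ne', div_eq_inv_mul]

lemma exists_tvec_bounds (J : (Ideal (𝓞 L))⁰) : ∃ ε A : ℝ, 0 < ε ∧ ε ≤ 1 ∧ 0 < A ∧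
    ∀ y : ℝ, 0 < y → ∀ c ∈ unitCube (Fin (rank F)), ∀ w,
      ε * y ^ (1 / Fintype.card (InfinitePlace F) : ℝ) ≤ T.tvec J y c w ∧
      T.tvec J y c w ≤ A * y ^ (1 / Fintype.card (InfinitePlace F) : ℝ) := by
  have hN := absNorm_pos J
  set b : InfinitePlace L → Fin (rank F) → ℝ :=
    fun w i => 2 * Real.log (T.e.symm w (fundSystem F i : F)) with hb
  set M := ∑ w, ∑ i, |b w i| with hM
  set R := (Ideal.absNorm (J : Ideal (𝓞 L)) : ℝ) ^
    (-2 / (T.m * Fintype.card (InfinitePlace F)) : ℝ) with hR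
  have hR0 : 0 < R := by positivity
  have key : ∀ c ∈ unitCube (Fin (rank F)), ∀ w, |∑ i, c i * b w i| ≤ M := by
    intro c hc w
    refine (Finset.abs_sum_le_sum_abs _ _).trans (le_trans ?_
      (Finset.single_le_sum (f := fun w => ∑ i, |b w i|)
        (fun _ _ => Finset.sum_nonneg fun _ _ => abs_nonneg _) (Finset.mem_univ w)))
    refine Finset.sum_le_sum fun i _ => ?_
    have hci : 0 < c i ∧ c i ≤ 1 := hc i trivial
    rw [abs_mul, abs_of_pos hci.1]
    exact mul_le_of_le_one_left (abs_nonneg _) hci.2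
  refine ⟨min 1 (R * Real.exp (-M)), R * Real.exp M, by positivity, min_le_left _ _,
    by positivity, fun y hy c hc w => ?_⟩
  have hk := abs_le.1 (key c hc w)
  have hy' : 0 < y ^ (1 / Fintype.card (InfinitePlace F) : ℝ) := by positivity
  have he1 := Real.exp_le_exp.2 hk.1
  have he2 := Real.exp_le_exp.2 hk.2
  unfold tvec
  constructor
  · calc _ ≤ R * Real.exp (-M) * y ^ (1 / Fintype.card (InfinitePlace F) : ℝ) :=
          mul_le_mul_of_nonneg_right (min_le_right _ _) hy'.le
      _ = R * (y ^ (1 / Fintype.card (InfinitePlace F) : ℝ) * Real.exp (-M)) := by ring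
      _ ≤ _ := by gcongr
  · calc _ ≤ R * (y ^ (1 / Fintype.card (InfinitePlace F) : ℝ) * Real.exp M) := by gcongr
      _ = _ := by ring

lemma setLIntegral_unitCube_const {ι : Type*} [Fintype ι] (x : ENNReal) :
    ∫⁻ _ in unitCube ι, x = x := by
  rw [setLIntegral_const, volume_unitCube, mul_one]

lemma setLIntegral_unitCube_le {ι : Type*} [Fintype ι] {f : (ι → ℝ) → ENNReal} {x : ENNReal}
    (h : ∀ c ∈ unitCube ι, f c ≤ x) : ∫⁻ c in unitCube ι, f c ≤ x :=
  (setLIntegral_mono' measurableSet_unitCube h).trans (setLIntegral_unitCube_const x).le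

lemma le_one_add_lintegral_idealGauss (J : (Ideal (𝓞 L))⁰) {y : ℝ} (hy : 0 < y) :
    ENNReal.ofReal (gaussCoef L * y ^ (-(T.m : ℝ) / 2)) ≤
      1 + ∫⁻ c in unitCube (Fin (rank F)), idealGauss J (T.tvec J y c) := by
  rw [← setLIntegral_unitCube_const (ι := Fin (rank F)) 1, ← lintegral_add_left measurable_const,
    ← setLIntegral_unitCube_const (ι := Fin (rank F)) (ENNReal.ofReal _)]
  refine lintegral_mono fun c => ?_
  rw [← T.idealGaussMain_tvec J hy c]
  exact idealGaussMain_le_one_add J _ (T.tvec_pos J hy c)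

lemma le_add_thetaInt (J : ClassGroup (𝓞 L) → (Ideal (𝓞 L))⁰) {y : ℝ} (hy : 0 < y) :
    classNumber L * ENNReal.ofReal (gaussCoef L * y ^ (-(T.m : ℝ) / 2)) ≤
      classNumber L + T.thetaInt J y := by
  rw [thetaInt, tsum_fintype, classNumber, ← nsmul_eq_mul, ← Finset.card_univ,
    ← Finset.sum_const, Finset.card_eq_sum_ones, Nat.cast_sum, Nat.cast_one,
    ← Finset.sum_add_distrib]
  exact Finset.sum_le_sum fun C _ => T.le_one_add_lintegral_idealGauss (J C) hy

lemma exists_sum_ofReal_le {ι : Type*} [Fintype ι] {X : Type*} {P : X → Prop}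
    {f : ι → X → ENNReal} {a b : X → ℝ} (ha : ∀ x, P x → 0 ≤ a x) (hb : ∀ x, P x → 0 ≤ b x)
    (h : ∀ i, ∃ C : ℝ, 0 ≤ C ∧ ∀ x, P x → f i x ≤ ENNReal.ofReal (a x + C * b x)) :
    ∃ C : ℝ, 0 ≤ C ∧ ∀ x, P x →
      ∑ i, f i x ≤ ENNReal.ofReal (Fintype.card ι * a x + C * b x) := by
  choose C hC0 hC using h
  refine ⟨∑ i, C i, Finset.sum_nonneg fun i _ => hC0 i, fun x hx => ?_⟩
  refine (Finset.sum_le_sum fun i _ => hC i x hx).trans ?_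
  rw [← ENNReal.ofReal_sum_of_nonneg fun i _ =>
    add_nonneg (ha x hx) (mul_nonneg (hC0 i) (hb x hx))]
  simp [Finset.sum_add_distrib, Finset.sum_mul]

lemma exists_thetaInt_le (J : ClassGroup (𝓞 L) → (Ideal (𝓞 L))⁰) :
    ∃ C : ℝ, 0 ≤ C ∧ ∀ y : ℝ, 0 < y ∧ y ≤ 1 → T.thetaInt J y ≤
      ENNReal.ofReal (classNumber L * (gaussCoef L * y ^ (-(T.m : ℝ) / 2)) + C) := by
  have := exists_sum_ofReal_le (P := fun y : ℝ => 0 < y ∧ y ≤ 1)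
    (f := fun C y => ∫⁻ c in unitCube (Fin (rank F)), idealGauss (J C) (T.tvec (J C) y c))
    (a := fun y => gaussCoef L * y ^ (-(T.m : ℝ) / 2)) (b := fun _ => 1)
    (fun y hy => mul_nonneg (gaussCoef_pos L).le (Real.rpow_nonneg hy.1.le _))
    (fun _ _ => zero_le_one) (fun C => by
      obtain ⟨ε, A, hε, hε1, hA, hb⟩ := T.exists_tvec_bounds (J C)
      obtain ⟨K, hK, h⟩ := idealGauss_le_main_add (J C) hε hε1 hA
      refine ⟨K, hK, fun y hy => setLIntegral_unitCube_le fun c hc => ?_⟩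
      rw [← T.idealGaussMain_tvec (J C) hy.1 c, mul_one]
      exact h _ _ (Real.rpow_pos_of_pos hy.1 _)
        (Real.rpow_le_one hy.1.le hy.2 (by positivity)) (hb y hy.1 c hc))
  simpa only [thetaInt, tsum_fintype, mul_one, classNumber] using this

lemma exists_thetaInt_le_pow (J : ClassGroup (𝓞 L) → (Ideal (𝓞 L))⁰) (N : ℕ) :
    ∃ C : ℝ, 0 ≤ C ∧ ∀ y : ℝ, 1 ≤ y → T.thetaInt J y ≤
      ENNReal.ofReal (C * ((y ^ (1 / Fintype.card (InfinitePlace F) : ℝ))⁻¹) ^ N) := by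
  have := exists_sum_ofReal_le (P := fun y : ℝ => 1 ≤ y)
    (f := fun C y => ∫⁻ c in unitCube (Fin (rank F)), idealGauss (J C) (T.tvec (J C) y c))
    (a := fun _ => 0) (b := fun y => ((y ^ (1 / Fintype.card (InfinitePlace F) : ℝ))⁻¹) ^ N)
    (fun _ _ => le_rfl) (fun y (hy : 1 ≤ y) => by positivity) (fun C => by
      obtain ⟨ε, A, hε, hε1, hA, hb⟩ := T.exists_tvec_bounds (J C)
      obtain ⟨K, hK, h⟩ := idealGauss_le_pow (J C) hε N
      refine ⟨K, hK, fun y hy => setLIntegral_unitCube_le fun c hc => ?_⟩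
      rw [zero_add]
      exact h _ _ (Real.one_le_rpow hy (by positivity))
        fun w => (hb y (by linarith) c hc w).1)
  simpa only [thetaInt, tsum_fintype, mul_zero, zero_add] using this

end PlaceTower

namespace PlaceTower
open NumberField.Units NumberField.InfinitePlace
variable {F L : Type} [Field F] [NumberField F] [Field L] [NumberField L] [Algebra F L]
variable (T : PlaceTower F L)

lemma placeForm_algebraMap (t : InfinitePlace L → ℝ) (α : 𝓞 F) :
    placeForm t (algebraMap (𝓞 F) (𝓞 L) α) = placeForm (fun v => t (T.e v)) α := by
  rw [placeForm, placeForm, ← T.e.sum_comp]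
  refine Finset.sum_congr rfl fun v _ => ?_
  rw [← T.e_apply]
  rfl

lemma idealGauss_one_le (t : InfinitePlace L → ℝ) :
    idealGauss (1 : (Ideal (𝓞 F))⁰) (fun v => t (T.e v)) ≤ idealGauss (1 : (Ideal (𝓞 L))⁰) t := by
  have hinj := FaithfulSMul.algebraMap_injective (𝓞 F) (𝓞 L)
  let i : {α : 𝓞 F // α ∈ ((1 : (Ideal (𝓞 F))⁰) : Ideal (𝓞 F)) ∧ α ≠ 0} →
      {α : 𝓞 L // α ∈ ((1 : (Ideal (𝓞 L))⁰) : Ideal (𝓞 L)) ∧ α ≠ 0} :=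
    fun α => ⟨algebraMap (𝓞 F) (𝓞 L) α, by simp, by
      rw [Ne, map_eq_zero_iff _ hinj]; exact α.2.2⟩
  have hi : Function.Injective i := fun α β h =>
    Subtype.ext (hinj (congrArg Subtype.val h))
  refine le_trans (le_of_eq ?_) (ENNReal.tsum_comp_le_tsum_of_injective hi
    fun α => ENNReal.ofReal (Real.exp (-Real.pi * placeForm t α)))
  refine tsum_congr fun α => ?_
  change _ = ENNReal.ofReal (Real.exp (-Real.pi * placeForm t (algebraMap (𝓞 F) (𝓞 L) α)))
  rw [T.placeForm_algebraMap]

lemma le_one_add_thetaInt {J : ClassGroup (𝓞 L) → (Ideal (𝓞 L))⁰} (hJ : J 1 = 1) {y : ℝ}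
    (hy : 0 < y) :
    ENNReal.ofReal (gaussCoef F * y ^ (-1 / 2 : ℝ)) ≤ 1 + T.thetaInt J y := by
  have h1 : ∫⁻ c in unitCube (Fin (rank F)), idealGauss 1 (T.tvec 1 y c) ≤ T.thetaInt J y := by
    have := ENNReal.le_tsum (f := fun C =>
      ∫⁻ c in unitCube (Fin (rank F)), idealGauss (J C) (T.tvec (J C) y c)) 1
    rwa [hJ] at this
  refine le_trans ?_ (add_le_add le_rfl h1)
  rw [← setLIntegral_unitCube_const (ι := Fin (rank F)) 1, ← lintegral_add_left measurable_const,
    ← setLIntegral_unitCube_const (ι := Fin (rank F)) (ENNReal.ofReal _)]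
  refine lintegral_mono fun c => ?_
  have h2 := idealGaussMain_le_one_add (1 : (Ideal (𝓞 F))⁰) (fun v => T.tvec 1 y c (T.e v))
    fun v => T.tvec_pos 1 hy c _
  refine le_trans (le_of_eq ?_) (h2.trans (add_le_add le_rfl (T.idealGauss_one_le _)))
  have hm : ∀ v : InfinitePlace F, v.mult = 1 := fun v => mult_isReal ⟨v, T.isReal v⟩
  have h3 := T.prod_tvec 1 hy c
  rw [← T.e.prod_comp] at h3
  simp only [idealGaussMain, idealCovolume, hm, gaussCoef, Nat.cast_one]
  rw [Real.finsetProd_rpow _ _ (fun w _ => (T.tvec_pos 1 hy c _).le), h3]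
  simp [div_eq_inv_mul]

/-- The real-valued theta function. -/
noncomputable def theta (J : ClassGroup (𝓞 L) → (Ideal (𝓞 L))⁰) (y : ℝ) : ℝ :=
  (T.thetaInt J y).toReal

variable (J : ClassGroup (𝓞 L) → (Ideal (𝓞 L))⁰)

lemma theta_nonneg (y : ℝ) : 0 ≤ T.theta J y := ENNReal.toReal_nonneg

lemma measurable_theta : Measurable (T.theta J) := (T.measurable_thetaInt J).ennreal_toReal

lemma ofReal_theta {y : ℝ} (hy : 0 < y) : ENNReal.ofReal (T.theta J y) = T.thetaInt J y := by
  refine ENNReal.ofReal_toReal (ne_of_lt ?_)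
  rcases le_total y 1 with h | h
  · obtain ⟨C, -, hC⟩ := T.exists_thetaInt_le J
    exact (hC y ⟨hy, h⟩).trans_lt ENNReal.ofReal_lt_top
  · obtain ⟨C, -, hC⟩ := T.exists_thetaInt_le_pow J 0
    exact (hC y h).trans_lt ENNReal.ofReal_lt_top

lemma sub_le_theta {y : ℝ} (hy : 0 < y) :
    classNumber L * (gaussCoef L * y ^ (-(T.m : ℝ) / 2)) - classNumber L ≤ T.theta J y := by
  have h := T.le_add_thetaInt J hy
  rw [← T.ofReal_theta J hy, ← ENNReal.ofReal_natCast, ← ENNReal.ofReal_mul (Nat.cast_nonneg _),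
    ← ENNReal.ofReal_add (Nat.cast_nonneg _) (T.theta_nonneg J y),
    ENNReal.ofReal_le_ofReal_iff (add_nonneg (Nat.cast_nonneg _) (T.theta_nonneg J y))] at h
  linarith

lemma sub_one_le_theta {J : ClassGroup (𝓞 L) → (Ideal (𝓞 L))⁰} (hJ : J 1 = 1) {y : ℝ}
    (hy : 0 < y) : gaussCoef F * y ^ (-1 / 2 : ℝ) - 1 ≤ T.theta J y := by
  have h := T.le_one_add_thetaInt hJ hy
  rw [← T.ofReal_theta J hy, ← ENNReal.ofReal_one,
    ← ENNReal.ofReal_add zero_le_one (T.theta_nonneg J y),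
    ENNReal.ofReal_le_ofReal_iff (add_nonneg zero_le_one (T.theta_nonneg J y))] at h
  linarith

lemma exists_theta_le : ∃ C : ℝ, 0 ≤ C ∧ ∀ y : ℝ, 0 < y →
    T.theta J y ≤ classNumber L * (gaussCoef L * y ^ (-(T.m : ℝ) / 2)) + C := by
  obtain ⟨C, hC0, hC⟩ := T.exists_thetaInt_le J
  obtain ⟨C', hC0', hC'⟩ := T.exists_thetaInt_le_pow J 0
  have hg := (gaussCoef_pos L).le
  refine ⟨C + C', add_nonneg hC0 hC0', fun y hy => ?_⟩
  have hp : 0 ≤ classNumber L * (gaussCoef L * y ^ (-(T.m : ℝ) / 2)) := by positivity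
  rcases le_total y 1 with h | h
  · have := hC y ⟨hy, h⟩
    rw [← T.ofReal_theta J hy, ENNReal.ofReal_le_ofReal_iff (by positivity)] at this
    linarith
  · have := hC' y h
    rw [← T.ofReal_theta J hy, ENNReal.ofReal_le_ofReal_iff (by positivity)] at this
    simp only [pow_zero, mul_one] at this
    linarith

lemma theta_isBigO_atTop (A : ℝ) : (fun y => (T.theta J y : ℂ)) =O[atTop] fun y => y ^ (-A) := by
  have hc := card_pos (F := F)
  obtain ⟨N, hN⟩ := exists_nat_ge (A * Fintype.card (InfinitePlace F))
  obtain ⟨C, hC0, hC⟩ := T.exists_thetaInt_le_pow J N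
  refine Asymptotics.IsBigO.of_bound C ?_
  filter_upwards [eventually_ge_atTop 1] with y hy
  have hy0 : 0 < y := by linarith
  have := hC y hy
  rw [← T.ofReal_theta J hy0, ENNReal.ofReal_le_ofReal_iff (by positivity)] at this
  rw [Complex.norm_real, Real.norm_of_nonneg (T.theta_nonneg J y),
    Real.norm_of_nonneg (by positivity)]
  refine this.trans (mul_le_mul_of_nonneg_left ?_ hC0)
  rw [← Real.rpow_neg hy0.le, ← Real.rpow_natCast, ← Real.rpow_mul hy0.le]
  refine Real.rpow_le_rpow_of_exponent_le hy ?_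
  rw [neg_mul, neg_le_neg_iff, one_div, inv_mul_eq_div, le_div_iff₀ hc]
  exact hN

lemma locallyIntegrableOn_theta :
    LocallyIntegrableOn (fun y => (T.theta J y : ℂ)) (Set.Ioi 0) := by
  obtain ⟨C, hC0, hC⟩ := T.exists_theta_le J
  have hcont : ContinuousOn (fun y : ℝ =>
      classNumber L * (gaussCoef L * y ^ (-(T.m : ℝ) / 2)) + C) (Set.Ioi 0) := by
    refine ContinuousOn.add (continuousOn_const.mul (continuousOn_const.mul
      (continuousOn_id.rpow_const fun y hy => Or.inl (ne_of_gt hy)))) continuousOn_const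
  rw [locallyIntegrableOn_iff isLocallyClosed_Ioi]
  intro k hk hkc
  have h1 := (hcont.mono hk).integrableOn_compact hkc (μ := volume)
  refine h1.mono' (Complex.measurable_ofReal.comp (T.measurable_theta J)).aestronglyMeasurable ?_
  refine (ae_restrict_iff' hkc.measurableSet).2 (ae_of_all _ fun y hy => ?_)
  rw [Complex.norm_real, Real.norm_of_nonneg (T.theta_nonneg J y)]
  exact hC y (hk hy)

lemma theta_isBigO_zero :
    (fun y => (T.theta J y : ℂ)) =O[𝓝[>] 0] fun y => y ^ (-((T.m : ℝ) / 2)) := by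
  obtain ⟨C, hC0, hC⟩ := T.exists_theta_le J
  have hg := (gaussCoef_pos L).le
  refine Asymptotics.IsBigO.of_bound (classNumber L * gaussCoef L + C) ?_
  filter_upwards [Ioc_mem_nhdsGT (zero_lt_one' ℝ)] with y hy
  have h1 : 1 ≤ y ^ (-((T.m : ℝ) / 2)) :=
    Real.one_le_rpow_of_pos_of_le_one_of_nonpos hy.1 hy.2 (by have := T.m_pos; linarith)
  rw [Complex.norm_real, Real.norm_of_nonneg (T.theta_nonneg J y),
    Real.norm_of_nonneg (by positivity)]
  refine (hC y hy.1).trans ?_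
  rw [neg_div]
  nlinarith

end PlaceTower

lemma integrableOn_of_mellinConvergent_ofReal {f : ℝ → ℝ} {σ : ℝ}
    (h : MellinConvergent (fun y => (f y : ℂ)) σ) :
    IntegrableOn (fun y => f y * y ^ (σ - 1)) (Set.Ioi 0) := by
  refine (Integrable.re h).congr ?_
  refine (ae_restrict_iff' measurableSet_Ioi).2 (ae_of_all _ fun y (hy : 0 < y) => ?_)
  simp only [smul_eq_mul, ← Complex.ofReal_one, ← Complex.ofReal_sub,
    ← Complex.ofReal_cpow hy.le, ← Complex.ofReal_mul, RCLike.re_eq_complex_re,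
    Complex.ofReal_re]
  ring

namespace PlaceTower
open NumberField.Units NumberField.InfinitePlace
variable {F L : Type} [Field F] [NumberField F] [Field L] [NumberField L] [Algebra F L]
variable (T : PlaceTower F L)

lemma gammaFactor_pos {s : ℝ} (hs : 0 < s) : 0 < T.gammaFactor s := by
  have := T.m_pos
  exact pow_pos (mul_pos (by positivity) (Real.Gamma_pos_of_pos (by positivity))) _

lemma mellinConvergent_theta (J : ClassGroup (𝓞 L) → (Ideal (𝓞 L))⁰) {s : ℂ}
    (hs : (T.m : ℝ) / 2 < s.re) : MellinConvergent (fun y => (T.theta J y : ℂ)) s :=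
  mellinConvergent_of_isBigO_rpow (T.locallyIntegrableOn_theta J)
    (T.theta_isBigO_atTop J (s.re + 1)) (lt_add_one _) (T.theta_isBigO_zero J) hs

lemma integrableOn_theta (J : ClassGroup (𝓞 L) → (Ideal (𝓞 L))⁰) {σ : ℝ}
    (hs : (T.m : ℝ) / 2 < σ) :
    IntegrableOn (fun y => T.theta J y * y ^ (σ - 1)) (Set.Ioi 0) :=
  integrableOn_of_mellinConvergent_ofReal (T.mellinConvergent_theta J (by simpa using hs))

lemma lintegral_thetaInt_eq_ofReal (J : ClassGroup (𝓞 L) → (Ideal (𝓞 L))⁰) {σ : ℝ}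
    (hs : (T.m : ℝ) / 2 < σ) :
    ∫⁻ y in Set.Ioi 0, T.thetaInt J y * ENNReal.ofReal (y ^ (σ - 1)) =
      ENNReal.ofReal (∫ y in Set.Ioi 0, T.theta J y * y ^ (σ - 1)) := by
  rw [ofReal_integral_eq_lintegral_ofReal (T.integrableOn_theta J hs)]
  · refine setLIntegral_congr_fun measurableSet_Ioi fun y (hy : 0 < y) => ?_
    rw [ENNReal.ofReal_mul (T.theta_nonneg J y), T.ofReal_theta J hy]
  · exact (ae_restrict_iff' measurableSet_Ioi).2 (ae_of_all _ fun y (hy : 0 < y) =>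
      mul_nonneg (T.theta_nonneg J y) (by positivity))

variable (F) in
lemma exists_integral_theta (hF : ∀ v : InfinitePlace F, v.IsReal) :
    ∃ κ : ℝ, 0 < κ ∧ ∀ {L : Type} [Field L] [NumberField L] [Algebra F L]
      (T : PlaceTower F L) {J : ClassGroup (𝓞 L) → (Ideal (𝓞 L))⁰}
      (_ : ∀ C, ClassGroup.mk0 (J C) = C) {s : ℝ} (_ : 1 < s),
      (unitsMap F L).range.index ≠ 0 ∧
      Summable (fun I : (Ideal (𝓞 L))⁰ =>
        (Ideal.absNorm (I : Ideal (𝓞 L)) : ℝ) ^ (-s)) ∧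
      ∫ y in Set.Ioi 0, T.theta J y * y ^ (T.m * s / 2 - 1) =
        (unitsMap F L).range.index * (κ * T.gammaFactor s *
          ∑' I : (Ideal (𝓞 L))⁰, (Ideal.absNorm (I : Ideal (𝓞 L)) : ℝ) ^ (-s)) := by
  obtain ⟨κ, hκ0, hκ⟩ := exists_lintegral_thetaInt F hF
  refine ⟨κ, by positivity, fun {L} _ _ _ T J hJ s hs => ?_⟩
  have hs0 : 0 < s := by linarith
  have hm := T.m_pos
  have h := hκ T hJ hs0
  have hG := T.gammaFactor_pos hs0
  rw [T.lintegral_thetaInt_eq_ofReal J (by nlinarith)] at h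
  set R := ∫ y in Set.Ioi 0, T.theta J y * y ^ (T.m * s / 2 - 1) with hR
  have hR0 : 0 ≤ R := setIntegral_nonneg measurableSet_Ioi fun y (hy : 0 < y) =>
    mul_nonneg (T.theta_nonneg J y) (by positivity)
  set S := ∑' I : (Ideal (𝓞 L))⁰,
    ENNReal.ofReal ((Ideal.absNorm (I : Ideal (𝓞 L)) : ℝ) ^ (-s)) with hS
  have hS0 : S ≠ 0 := by
    have := ENNReal.le_tsum (f := fun I : (Ideal (𝓞 L))⁰ =>
      ENNReal.ofReal ((Ideal.absNorm (I : Ideal (𝓞 L)) : ℝ) ^ (-s))) 1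
    rw [← hS] at this
    refine ne_of_gt (lt_of_lt_of_le ?_ this)
    simp
  have hx0 : (κ : ENNReal) * ENNReal.ofReal (T.gammaFactor s) ≠ 0 :=
    mul_ne_zero (by simpa using hκ0) (by simpa using hG)
  have htop : ENNReal.ofReal R ≠ ⊤ := ENNReal.ofReal_ne_top
  have hfin : Finite ((𝓞 L)ˣ ⧸ (unitsMap F L).range) := by
    by_contra hinf
    rw [not_finite_iff_infinite] at hinf
    rw [ENat.card_eq_top_of_infinite, ENat.toENNReal_top,
      ENNReal.top_mul (mul_ne_zero hx0 hS0)] at h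
    exact htop h
  have hidx : Nat.card ((𝓞 L)ˣ ⧸ (unitsMap F L).range) ≠ 0 := Nat.card_pos.ne'
  rw [ENat.card_eq_coe_natCard, ENat.toENNReal_coe] at h
  have hS1 : S ≠ ⊤ := by
    intro hS'
    rw [hS', ENNReal.mul_top hx0, ENNReal.mul_top (Nat.cast_ne_zero.2 hidx)] at h
    exact htop h
  have hsum : Summable fun I : (Ideal (𝓞 L))⁰ =>
      (Ideal.absNorm (I : Ideal (𝓞 L)) : ℝ) ^ (-s) := by
    refine (ENNReal.summable_toReal hS1).congr fun I => ?_
    exact ENNReal.toReal_ofReal (by positivity)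
  refine ⟨hidx, hsum, ?_⟩
  have h2 := congrArg ENNReal.toReal h
  rw [ENNReal.toReal_ofReal hR0, hS, ← ENNReal.ofReal_tsum_of_nonneg
    (fun _ => by positivity) hsum] at h2
  simp only [ENNReal.toReal_mul, ENNReal.toReal_natCast, ENNReal.coe_toReal,
    ENNReal.toReal_ofReal hG.le, ENNReal.toReal_ofReal (tsum_nonneg fun I : (Ideal (𝓞 L))⁰ =>
      (by positivity : (0 : ℝ) ≤ (Ideal.absNorm (I : Ideal (𝓞 L)) : ℝ) ^ (-s)))] at h2
  exact h2

end PlaceTower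

lemma integrableOn_Ioc_rpow {r X : ℝ} (hr : -1 < r) (hX : 0 < X) :
    IntegrableOn (fun y : ℝ => y ^ r) (Set.Ioc 0 X) :=
  (intervalIntegrable_iff_integrableOn_Ioc_of_le hX.le).1
    (intervalIntegral.intervalIntegrable_rpow' hr)

lemma setIntegral_Ioc_rpow {r X : ℝ} (hr : -1 < r) (hX : 0 < X) :
    ∫ y in Set.Ioc 0 X, y ^ r = X ^ (r + 1) / (r + 1) := by
  rw [← intervalIntegral.integral_of_le hX.le, integral_rpow (Or.inl hr),
    Real.zero_rpow (by linarith), sub_zero]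

lemma integrableOn_Ioc_main {p σ a b X : ℝ} (hp : 0 < p) (hσ : p < σ) (hX : 0 < X) :
    IntegrableOn (fun y => (a * y ^ (-p) + b) * y ^ (σ - 1)) (Set.Ioc 0 X) := by
  have h1 := (integrableOn_Ioc_rpow (r := σ - p - 1) (by linarith) hX).const_mul a
  have h2 := (integrableOn_Ioc_rpow (r := σ - 1) (by linarith) hX).const_mul b
  refine IntegrableOn.congr_fun (h1.add h2) (fun y hy => ?_) measurableSet_Ioc
  simp only [Pi.add_apply]
  rw [add_mul, mul_assoc, ← Real.rpow_add hy.1]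
  ring_nf

lemma setIntegral_Ioc_main {p σ a b X : ℝ} (hp : 0 < p) (hσ : p < σ) (hX : 0 < X) :
    ∫ y in Set.Ioc 0 X, (a * y ^ (-p) + b) * y ^ (σ - 1) =
      a * (X ^ (σ - p) / (σ - p)) + b * (X ^ σ / σ) := by
  have h1 := (integrableOn_Ioc_rpow (r := σ - p - 1) (by linarith) hX).const_mul a
  have h2 := (integrableOn_Ioc_rpow (r := σ - 1) (by linarith) hX).const_mul b
  have : ∀ y ∈ Set.Ioc 0 X, (a * y ^ (-p) + b) * y ^ (σ - 1) =
      a * y ^ (σ - p - 1) + b * y ^ (σ - 1) := fun y hy => by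
    rw [add_mul, mul_assoc, ← Real.rpow_add hy.1]
    ring_nf
  rw [setIntegral_congr_fun measurableSet_Ioc this, integral_add h1 h2, integral_const_mul,
    integral_const_mul, setIntegral_Ioc_rpow (by linarith) hX,
    setIntegral_Ioc_rpow (by linarith) hX]
  simp

section
variable {f : ℝ → ℝ} {p σ a b : ℝ}

lemma le_integral_mul_rpow (hf : ∀ y, 0 ≤ f y) (hfa : ∀ y, 0 < y → a * y ^ (-p) + b ≤ f y)
    (hp : 0 < p) (hσ : p < σ) (h_int : IntegrableOn (fun y => f y * y ^ (σ - 1)) (Set.Ioi 0))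
    {X : ℝ} (hX : 0 < X) :
    a * (X ^ (σ - p) / (σ - p)) + b * (X ^ σ / σ) ≤ ∫ y in Set.Ioi 0, f y * y ^ (σ - 1) := by
  rw [← setIntegral_Ioc_main hp hσ hX]
  refine le_trans (setIntegral_mono_on (integrableOn_Ioc_main hp hσ hX)
    (h_int.mono_set Set.Ioc_subset_Ioi_self) measurableSet_Ioc fun y hy =>
      mul_le_mul_of_nonneg_right (hfa y hy.1) (Real.rpow_nonneg hy.1.le _)) ?_
  refine setIntegral_mono_set h_int ?_ Set.Ioc_subset_Ioi_self.eventuallyLE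
  exact (ae_restrict_iff' measurableSet_Ioi).2 (ae_of_all _ fun y (hy : 0 < y) =>
    mul_nonneg (hf y) (Real.rpow_nonneg hy.le _))

lemma exists_integral_mul_rpow_le (hf : ∀ y, 0 ≤ f y)
    (hfa : ∀ y, 0 < y → f y ≤ a * y ^ (-p) + b) (hb : 0 ≤ b) (hp : 0 < p)
    (h_int : ∀ σ, p < σ → IntegrableOn (fun y => f y * y ^ (σ - 1)) (Set.Ioi 0)) :
    ∃ C, ∀ σ, p < σ → σ ≤ p + 1 →
      ∫ y in Set.Ioi 0, f y * y ^ (σ - 1) ≤ a / (σ - p) + C := by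
  refine ⟨b / p + ∫ y in Set.Ioi 1, f y * y ^ (p + 1 - 1), fun σ hσ hσ1 => ?_⟩
  have h1 : Set.Ioi (1 : ℝ) ⊆ Set.Ioi 0 := Set.Ioi_subset_Ioi zero_le_one
  rw [← Set.Ioc_union_Ioi_eq_Ioi (zero_le_one' ℝ), setIntegral_union
    (Set.Ioc_disjoint_Ioi le_rfl) measurableSet_Ioi
    ((h_int σ hσ).mono_set Set.Ioc_subset_Ioi_self) ((h_int σ hσ).mono_set h1), ← add_assoc]
  refine add_le_add ?_ ?_
  · refine (setIntegral_mono_on ((h_int σ hσ).mono_set Set.Ioc_subset_Ioi_self)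
      (integrableOn_Ioc_main hp hσ one_pos) measurableSet_Ioc fun y hy =>
        mul_le_mul_of_nonneg_right (hfa y hy.1) (Real.rpow_nonneg hy.1.le _)).trans ?_
    rw [setIntegral_Ioc_main hp hσ one_pos, Real.one_rpow, Real.one_rpow, mul_one_div, mul_one_div]
    gcongr
  · refine setIntegral_mono_on ((h_int σ hσ).mono_set h1)
      ((h_int (p + 1) (by linarith)).mono_set h1)
      measurableSet_Ioi fun y (hy : 1 < y) => mul_le_mul_of_nonneg_left ?_ (hf y)
    exact Real.rpow_le_rpow_of_exponent_le hy.le (by linarith)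

end

/-- A squeeze argument computing the residue at `1`. -/
lemma residue_eq_of_bounds {I : ℝ → ℝ} {A C r : ℝ} {X : ℝ} (hX : 0 < X)
    (hI : Tendsto (fun s => (s - 1) * I s) (𝓝[>] 1) (𝓝 r)) {b : ℝ}
    (hlow : ∀ s, 1 < s → A * (X ^ (s - 1) / (s - 1)) + b * (X ^ s / s) ≤ I s)
    (hup : ∀ s, 1 < s → s ≤ 2 → I s ≤ A / (s - 1) + C) : r = A := by
  have hlin : Tendsto (fun s : ℝ => s - 1) (𝓝[>] 1) (𝓝 0) := by
    have : ContinuousAt (fun s : ℝ => s - 1) 1 := by fun_prop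
    simpa using this.tendsto.mono_left nhdsWithin_le_nhds
  have hev : ∀ᶠ s : ℝ in 𝓝[>] 1, 1 < s ∧ s ≤ 2 := Ioc_mem_nhdsGT (by norm_num)
  apply le_antisymm
  · have h : Tendsto (fun s : ℝ => A + C * (s - 1)) (𝓝[>] 1) (𝓝 A) := by
      simpa using (hlin.const_mul C).const_add A
    refine le_of_tendsto_of_tendsto hI h ?_
    filter_upwards [hev] with s hs
    have hs1 : 0 < s - 1 := by linarith
    calc _ ≤ (s - 1) * (A / (s - 1) + C) := mul_le_mul_of_nonneg_left (hup s hs.1 hs.2) hs1.le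
      _ = _ := by field_simp
  · have h : Tendsto (fun s : ℝ => A * X ^ (s - 1) + (s - 1) * (b * (X ^ s / s))) (𝓝[>] 1)
        (𝓝 A) := by
      have hc : ContinuousAt
          (fun s : ℝ => A * X ^ (s - 1) + (s - 1) * (b * (X ^ s / s))) 1 := by
        have h1 : ContinuousAt (fun s : ℝ => X ^ s) 1 :=
          (Real.continuous_const_rpow hX.ne').continuousAt
        have h2 : ContinuousAt (fun s : ℝ => X ^ (s - 1)) 1 :=
          ((Real.continuous_const_rpow hX.ne').comp (continuous_id.sub
            continuous_const)).continuousAt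
        have h3 : ContinuousAt (fun s : ℝ => X ^ s / s) 1 := h1.div continuousAt_id one_ne_zero
        exact (h2.const_mul A).add
          ((continuousAt_id.sub continuousAt_const).mul (h3.const_mul b))
      have := hc.tendsto.mono_left (nhdsWithin_le_nhds (s := Set.Ioi 1))
      simpa using this
    refine le_of_tendsto_of_tendsto h hI ?_
    filter_upwards [hev] with s hs
    have hs1 : 0 < s - 1 := by linarith
    calc _ = (s - 1) * (A * (X ^ (s - 1) / (s - 1)) + b * (X ^ s / s)) := by field_simp
      _ ≤ _ := mul_le_mul_of_nonneg_left (hlow s hs.1) hs1.le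

/-- The derivative at `1` of the archimedean factor of a totally real field of degree `n`. -/
lemma hasDerivAt_gammaFactor (n : ℕ) :
    HasDerivAt (fun s : ℝ => (Real.pi ^ (-(s / 2)) * Real.Gamma (s / 2)) ^ n)
      (-(n / 2 * (Real.log Real.pi + Real.eulerMascheroniConstant + 2 * Real.log 2))) 1 := by
  have hpi := Real.pi_pos
  have h0 : HasDerivAt (fun s : ℝ => s / 2) (1 / 2) 1 := (hasDerivAt_id 1).div_const 2
  have h1 : HasDerivAt (fun s : ℝ => Real.Gamma (s / 2)) _ 1 :=
    HasDerivAt.comp (1 : ℝ) (h := fun s : ℝ => s / 2) Real.hasDerivAt_Gamma_one_half h0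
  have h2 : HasDerivAt (fun s : ℝ => Real.pi ^ (-(s / 2))) _ 1 :=
    HasDerivAt.const_rpow (f := fun s : ℝ => -(s / 2)) hpi h0.neg
  have hs : Real.pi ^ (-(1 / 2) : ℝ) * √Real.pi = 1 := by
    rw [Real.sqrt_eq_rpow, ← Real.rpow_add hpi]; norm_num
  refine ((h2.mul h1).pow n).congr_deriv ?_
  simp only [Pi.mul_apply]
  rw [Real.Gamma_one_half_eq, hs, one_pow]
  linear_combination (-(n / 2 * (Real.log Real.pi + Real.eulerMascheroniConstant +
    2 * Real.log 2)) : ℝ) * hs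

/-- A lower bound for the constant term at `1`. -/
lemma le_constantTerm_of_bounds {Z : ℝ → ℝ} {a γ : ℝ} {n : ℕ} (ha : 0 < a)
    (hZ : Tendsto (fun s => Z s - 1 / (s - 1)) (𝓝[>] 1) (𝓝 γ))
    (hlow : ∀ s, 1 < s → a ^ (s - 1) / (s - 1) - a ^ (s - 1) / s ≤
      (Real.pi ^ (-(s / 2)) * Real.Gamma (s / 2)) ^ n * Z s) :
    Real.log a + n - 1 ≤ γ := by
  set G : ℝ → ℝ := fun s => (Real.pi ^ (-(s / 2)) * Real.Gamma (s / 2)) ^ n with hG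
  have hG' := hasDerivAt_gammaFactor n
  rw [← hG] at hG'
  have hG1 : G 1 = 1 := by
    have : Real.pi ^ (-(1 / 2) : ℝ) * √Real.pi = 1 := by
      rw [Real.sqrt_eq_rpow, ← Real.rpow_add Real.pi_pos]; norm_num
    simp only [hG]
    rw [Real.Gamma_one_half_eq, this, one_pow]
  have hA : HasDerivAt (fun s : ℝ => a ^ (s - 1)) (Real.log a) 1 := by
    simpa using HasDerivAt.const_rpow (f := fun s : ℝ => s - 1) ha ((hasDerivAt_id 1).sub_const 1)
  have hslope := (hasDerivAt_iff_tendsto_slope.1 (hA.sub hG')).mono_left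
    (nhdsWithin_mono _ fun s (hs : 1 < s) => ne_of_gt hs : 𝓝[>] (1 : ℝ) ≤ _)
  have hAs : Tendsto (fun s : ℝ => a ^ (s - 1) / s) (𝓝[>] 1) (𝓝 1) := by
    have : ContinuousAt (fun s : ℝ => a ^ (s - 1) / s) 1 :=
      hA.continuousAt.div continuousAt_id one_ne_zero
    simpa using this.tendsto.mono_left nhdsWithin_le_nhds
  have hGt : Tendsto G (𝓝[>] 1) (𝓝 1) := by
    simpa [hG1] using hG'.continuousAt.tendsto.mono_left (nhdsWithin_le_nhds (s := Set.Ioi 1))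
  have hlim := le_of_tendsto_of_tendsto (hslope.sub hAs) (hGt.mul hZ) (by
    filter_upwards [self_mem_nhdsWithin] with s (hs : 1 < s)
    have hs1 : s - 1 ≠ 0 := by linarith
    have := hlow s hs
    simp only [slope_def_field, Pi.sub_apply, hG1, sub_self, Real.rpow_zero, sub_zero]
    rw [mul_sub, mul_one_div, sub_div]
    linarith)
  have h1 : 1 ≤ Real.log Real.pi := by
    rw [Real.le_log_iff_exp_le Real.pi_pos]
    exact (Real.exp_one_lt_d9.trans (by have := Real.pi_gt_three; linarith)).le
  have h2 := Real.log_two_gt_d9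
  have h3 := Real.one_half_lt_eulerMascheroniConstant
  have h4 : (0 : ℝ) ≤ n := n.cast_nonneg
  nlinarith

namespace PlaceTower
open NumberField.Units NumberField.InfinitePlace
variable (F L : Type) [Field F] [NumberField F] [Field L] [NumberField L]

/-- A totally real field as an extension of itself. -/
noncomputable def refl (hF : ∀ v : InfinitePlace F, v.IsReal) : PlaceTower F F where
  e := Equiv.refl _
  m := 1
  e_apply _ _ := rfl
  mult_eq v := mult_isReal ⟨v, hF v⟩
  isReal := hF

lemma exists_class_representatives : ∃ J : ClassGroup (𝓞 L) → (Ideal (𝓞 L))⁰,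
    (∀ C, ClassGroup.mk0 (J C) = C) ∧ J 1 = 1 := by
  classical
  choose J hJ using ClassGroup.mk0_surjective (R := 𝓞 L)
  refine ⟨Function.update J 1 1, fun C => ?_, Function.update_self ..⟩
  rcases eq_or_ne C 1 with rfl | h
  · rw [Function.update_self, map_one]
  · rw [Function.update_of_ne h, hJ]

omit [NumberField F] in
lemma index_range_unitsMap_self : (unitsMap F F).range.index = 1 := by
  rw [Subgroup.index_eq_one, MonoidHom.range_eq_top]
  exact fun u => ⟨u, Units.ext rfl⟩

variable {F L}

lemma card_infinitePlace_eq (hF : ∀ v : InfinitePlace F, v.IsReal) :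
    Fintype.card (InfinitePlace F) = Module.finrank ℚ F := by
  rw [← sum_mult_eq, Finset.sum_congr rfl fun v _ => mult_isReal ⟨v, hF v⟩]
  simp

lemma gaussCoef_eq_of_isReal (hF : ∀ v : InfinitePlace F, v.IsReal) :
    gaussCoef F = (√((discr F).natAbs : ℝ))⁻¹ := by
  have : nrComplexPlaces F = 0 := by
    classical
    rw [nrComplexPlaces, Fintype.card_eq_zero_iff]
    exact ⟨fun v => not_isReal_iff_isComplex.2 v.2 (hF v.1)⟩
  rw [gaussCoef, this, pow_zero, one_mul, Nat.cast_natAbs, Int.cast_abs]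

section
variable {κ ρ γ : ℝ} (hF : ∀ v : InfinitePlace F, v.IsReal)
    {J : ClassGroup (𝓞 F) → (Ideal (𝓞 F))⁰}

include hF in
lemma le_integral_theta_refl {s : ℝ} (hs : 1 < s) :
    2 * classNumber F * gaussCoef F * (gaussCoef F ^ (s - 1) / (s - 1)) +
      -(2 * classNumber F) * (gaussCoef F ^ s / s) ≤
      ∫ y in Set.Ioi 0, (refl F hF).theta J y * y ^ (s / 2 - 1) := by
  have ha := gaussCoef_pos F
  have h := le_integral_mul_rpow (f := (refl F hF).theta J) (p := 1 / 2) (σ := s / 2)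
    (a := classNumber F * gaussCoef F) (b := -classNumber F) (theta_nonneg _ _)
    (fun y hy => by
      have := (refl F hF).sub_le_theta J hy
      simp only [refl, Nat.cast_one, neg_div] at this ⊢
      linarith) (by norm_num) (by linarith)
    ((refl F hF).integrableOn_theta J (by simp only [refl, Nat.cast_one]; linarith))
    (X := gaussCoef F ^ (2 : ℝ)) (by positivity)
  rw [← Real.rpow_mul ha.le, ← Real.rpow_mul ha.le, show (2 : ℝ) * (s / 2 - 1 / 2) = s - 1 by ring,
    show (2 : ℝ) * (s / 2) = s by ring] at h
  refine le_trans (le_of_eq ?_) h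
  have : s - 1 ≠ 0 := by linarith
  have : s ≠ 0 := by linarith
  field_simp

include hF in
lemma exists_integral_theta_refl_le : ∃ C, ∀ s, 1 < s → s ≤ 2 →
    ∫ y in Set.Ioi 0, (refl F hF).theta J y * y ^ (s / 2 - 1) ≤
      2 * classNumber F * gaussCoef F / (s - 1) + C := by
  obtain ⟨B, hB0, hB⟩ := (refl F hF).exists_theta_le J
  obtain ⟨C, hC⟩ := exists_integral_mul_rpow_le (f := (refl F hF).theta J) (p := 1 / 2)
    (a := classNumber F * gaussCoef F) (b := B) (theta_nonneg _ _)
    (fun y hy => by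
      have := hB y hy
      simp only [refl, Nat.cast_one, neg_div] at this ⊢
      linarith) hB0 (by norm_num)
    (fun σ hσ => (refl F hF).integrableOn_theta J (by simpa only [refl, Nat.cast_one] using hσ))
  refine ⟨C, fun s hs hs2 => (hC (s / 2) (by linarith) (by linarith)).trans (le_of_eq ?_)⟩
  have : s - 1 ≠ 0 := by linarith
  rw [show s / 2 - 1 / 2 = (s - 1) / 2 by ring]
  field_simp

variable (hκ : ∀ s, 1 < s → ∫ y in Set.Ioi 0, (refl F hF).theta J y * y ^ (s / 2 - 1) =
    κ * (Real.pi ^ (-(s / 2)) * Real.Gamma (s / 2)) ^ Module.finrank ℚ F * zetaSeries F s)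

include hκ in
lemma mul_residue_eq
    (hρ : Tendsto (fun s : ℝ => (s - 1) * zetaSeries F s) (𝓝[>] 1) (𝓝 ρ)) :
    κ * ρ = 2 * classNumber F * gaussCoef F := by
  obtain ⟨C, hC⟩ := exists_integral_theta_refl_le hF (J := J)
  refine residue_eq_of_bounds (gaussCoef_pos F) ?_
    (fun s hs => le_integral_theta_refl hF (J := J) hs) hC
  have hG := (hasDerivAt_gammaFactor (Module.finrank ℚ F)).continuousAt.tendsto.mono_left
    (nhdsWithin_le_nhds (s := Set.Ioi 1))
  have h1 : Real.pi ^ (-(1 / 2) : ℝ) * √Real.pi = 1 := by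
    rw [Real.sqrt_eq_rpow, ← Real.rpow_add Real.pi_pos]; norm_num
  rw [Real.Gamma_one_half_eq, h1, one_pow] at hG
  have h2 := (hG.mul hρ).const_mul κ
  rw [one_mul] at h2
  refine h2.congr' ?_
  filter_upwards [self_mem_nhdsWithin] with s (hs : 1 < s)
  rw [hκ s hs]
  ring

include hκ in
lemma le_eulerKronecker (hκ0 : 0 < κ)
    (hρ : Tendsto (fun s : ℝ => (s - 1) * zetaSeries F s) (𝓝[>] 1) (𝓝 ρ))
    (hγ : Tendsto (fun s : ℝ => ρ⁻¹ * zetaSeries F s - 1 / (s - 1)) (𝓝[>] 1) (𝓝 γ)) :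
    Real.log (gaussCoef F) + Module.finrank ℚ F - 1 ≤ γ := by
  have hres := mul_residue_eq hF hκ hρ
  have ha := gaussCoef_pos F
  have hh : (0 : ℝ) < classNumber F := by exact_mod_cast Fintype.card_pos
  have hρ0 : 0 < ρ := pos_of_mul_pos_right (by rw [hres]; positivity) hκ0.le
  refine le_constantTerm_of_bounds ha hγ fun s hs => ?_
  have h := le_integral_theta_refl hF (J := J) hs
  rw [hκ s hs] at h
  have hs1 : 0 < s - 1 := by linarith
  have hs0 : 0 < s := by linarith
  have h3 : gaussCoef F ^ s = gaussCoef F ^ (s - 1) * gaussCoef F := by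
    rw [← Real.rpow_add_one ha.ne']; ring_nf
  refine le_of_mul_le_mul_left ?_ (mul_pos hκ0 hρ0)
  calc _ = 2 * classNumber F * gaussCoef F * (gaussCoef F ^ (s - 1) / (s - 1)) +
      -(2 * classNumber F) * (gaussCoef F ^ s / s) := by rw [hres, h3]; ring
    _ ≤ _ := h
    _ = _ := by field_simp

end

end PlaceTower

lemma mellin_ofReal (g : ℝ → ℝ) (σ : ℝ) :
    mellin (fun y => (g y : ℂ)) σ = ((∫ y in Set.Ioi 0, g y * y ^ (σ - 1) : ℝ) : ℂ) := by
  rw [← integral_complex_ofReal, mellin]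
  refine setIntegral_congr_fun measurableSet_Ioi fun y (hy : 0 < y) => ?_
  simp only [smul_eq_mul, Complex.ofReal_mul]
  rw [Complex.ofReal_cpow hy.le, mul_comm]
  push_cast
  rfl

/-- Two functions holomorphic on `0 < re s` away from `1` that agree for real `s > 1` agree at
`1 / 2`. -/
lemma eq_at_half_of_eq_real {M N : ℂ → ℂ} (hM : ∀ s, 0 < s.re → s ≠ 1 → DifferentiableAt ℂ M s)
    (hN : ∀ s, 0 < s.re → s ≠ 1 → DifferentiableAt ℂ N s)
    (h : ∀ s : ℝ, 1 < s → M s = N s) : M (1 / 2) = N (1 / 2) := by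
  set U : Set ℂ := {s | 1 < s.re} ∪ ({s | 0 < s.re} ∩ {s | s.re - s.im < 1}) with hU
  have ho : IsOpen U := by
    refine (isOpen_lt continuous_const Complex.continuous_re).union
      ((isOpen_lt continuous_const Complex.continuous_re).inter
        (isOpen_lt (Complex.continuous_re.sub Complex.continuous_im) continuous_const))
  have hconn : IsPreconnected U := by
    refine IsPreconnected.union (2 + 2 * Complex.I) (by simp) (by simp)
      (convex_halfSpace_re_gt 1).isPreconnected
      ((convex_halfSpace_re_gt 0).inter ?_).isPreconnected
    exact convex_halfSpace_lt
      (f := fun s : ℂ => s.re - s.im) ⟨fun x y => by simp; ring, fun c x => by simp; ring⟩ 1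
  have hU1 : ∀ s ∈ U, 0 < s.re ∧ s ≠ 1 := by
    rintro s (hs | ⟨hs, hs'⟩)
    · refine ⟨zero_lt_one.trans hs, ?_⟩
      rintro rfl
      simp at hs
    · refine ⟨hs, ?_⟩
      rintro rfl
      simp at hs'
  have hMU : AnalyticOnNhd ℂ M U := DifferentiableOn.analyticOnNhd
    (fun s hs => (hM s (hU1 s hs).1 (hU1 s hs).2).differentiableWithinAt) ho
  have hNU : AnalyticOnNhd ℂ N U := DifferentiableOn.analyticOnNhd
    (fun s hs => (hN s (hU1 s hs).1 (hU1 s hs).2).differentiableWithinAt) ho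
  have h2 : ((2 : ℝ) : ℂ) ∈ U := Or.inl (by simp)
  refine hMU.eqOn_of_preconnected_of_frequently_eq hNU hconn h2 ?_
    (Or.inr ⟨by simp, by simp; norm_num⟩)
  have ht : Tendsto ((↑) : ℝ → ℂ) (𝓝[>] 2) (𝓝[≠] ((2 : ℝ) : ℂ)) := by
    refine tendsto_nhdsWithin_iff.2 ⟨Complex.continuous_ofReal.continuousAt.tendsto.mono_left
      nhdsWithin_le_nhds, ?_⟩
    filter_upwards [self_mem_nhdsWithin] with s (hs : 2 < s)
    exact Complex.ofReal_injective.ne (ne_of_gt hs)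
  refine ht.frequently (Eventually.frequently ?_)
  filter_upwards [self_mem_nhdsWithin] with s (hs : 2 < s)
  exact h s (by linarith)

/-- The function `f` with the polar term `H / y` removed on `(0, X]`. -/
noncomputable def removePole (f : ℝ → ℝ) (H X : ℝ) (y : ℝ) : ℝ :=
  f y - (Set.Ioc 0 X).indicator (fun y => H * y ^ (-1 : ℝ)) y

section removePole
variable {f : ℝ → ℝ} {H X h C : ℝ}

lemma removePole_of_mem {y : ℝ} (hy : y ∈ Set.Ioc 0 X) :
    removePole f H X y = f y - H * y ^ (-1 : ℝ) := by
  rw [removePole, Set.indicator_of_mem hy]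

lemma removePole_of_lt {y : ℝ} (hy : X < y) : removePole f H X y = f y := by
  rw [removePole, Set.indicator_of_notMem fun h => absurd h.2 (not_le.2 hy), sub_zero]

lemma locallyIntegrableOn_removePole
    (hf : LocallyIntegrableOn (fun y => (f y : ℂ)) (Set.Ioi 0)) :
    LocallyIntegrableOn (fun y => (removePole f H X y : ℂ)) (Set.Ioi 0) := by
  have hcont : ContinuousOn (fun y : ℝ => H * y ^ (-1 : ℝ)) (Set.Ioi 0) :=
    continuousOn_const.mul (continuousOn_id.rpow_const fun y hy => Or.inl (ne_of_gt hy))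
  rw [locallyIntegrableOn_iff isLocallyClosed_Ioi] at hf ⊢
  intro k hk hkc
  have h1 : IntegrableOn _ k := (hcont.mono hk).integrableOn_compact hkc (μ := volume)
  have h2 : IntegrableOn _ k := (h1.indicator (measurableSet_Ioc (a := 0) (b := X))).ofReal (𝕜 := ℂ)
  refine IntegrableOn.congr_fun ((hf k hk hkc).sub h2) (fun y _ => ?_) hkc.measurableSet
  simp [removePole]

lemma removePole_isBigO_atTop {A : ℝ}
    (hf : (fun y => (f y : ℂ)) =O[atTop] fun y => y ^ (-A)) :
    (fun y => (removePole f H X y : ℂ)) =O[atTop] fun y => y ^ (-A) := by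
  refine hf.congr' ?_ EventuallyEq.rfl
  filter_upwards [eventually_gt_atTop X] with y hy
  rw [removePole_of_lt hy]

lemma removePole_isBigO_zero (hX : 0 < X) (hlow : ∀ y, 0 < y → H * y ^ (-1 : ℝ) - h ≤ f y)
    (hup : ∀ y, 0 < y → f y ≤ H * y ^ (-1 : ℝ) + C) :
    (fun y => (removePole f H X y : ℂ)) =O[𝓝[>] 0] fun y => y ^ (-(0 : ℝ)) := by
  refine Asymptotics.IsBigO.of_bound (max h C) ?_
  filter_upwards [Ioc_mem_nhdsGT hX] with y hy
  rw [Complex.norm_real, removePole_of_mem hy, Real.norm_eq_abs, neg_zero, Real.rpow_zero,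
    norm_one, mul_one, abs_le]
  have h1 := hlow y hy.1
  have h2 := hup y hy.1
  exact ⟨by linarith [le_max_left h C], by linarith [le_max_right h C]⟩

variable (hX : 0 < X) (hloc : LocallyIntegrableOn (fun y => (f y : ℂ)) (Set.Ioi 0))
    (htop : ∀ A : ℝ, (fun y => (f y : ℂ)) =O[atTop] fun y => y ^ (-A))
    (hlow : ∀ y, 0 < y → H * y ^ (-1 : ℝ) - h ≤ f y)
    (hup : ∀ y, 0 < y → f y ≤ H * y ^ (-1 : ℝ) + C)

include hX hloc htop hlow hup

lemma differentiableAt_mellin_removePole {s : ℂ} (hs : 0 < s.re) :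
    DifferentiableAt ℂ (mellin fun y => (removePole f H X y : ℂ)) s :=
  mellin_differentiableAt_of_isBigO_rpow (locallyIntegrableOn_removePole hloc)
    (removePole_isBigO_atTop (htop (s.re + 1))) (lt_add_one _)
    (removePole_isBigO_zero hX hlow hup) hs

lemma integrableOn_removePole {σ : ℝ} (hσ : 0 < σ) :
    IntegrableOn (fun y => removePole f H X y * y ^ (σ - 1)) (Set.Ioi 0) :=
  integrableOn_of_mellinConvergent_ofReal
    (mellinConvergent_of_isBigO_rpow (locallyIntegrableOn_removePole hloc)
      (removePole_isBigO_atTop (htop (σ + 1))) (by simp)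
      (removePole_isBigO_zero hX hlow hup) (by simpa using hσ))

lemma integral_removePole {σ : ℝ} (hσ : 1 < σ) :
    (∫ y in Set.Ioi 0, removePole f H X y * y ^ (σ - 1)) + H * (X ^ (σ - 1) / (σ - 1)) =
      ∫ y in Set.Ioi 0, f y * y ^ (σ - 1) := by
  have h1 := integrableOn_removePole hX hloc htop hlow hup (σ := σ) (by linarith)
  have h2 := integrableOn_Ioc_main (a := H) (b := 0) (p := 1) one_pos hσ hX
  have h3 := setIntegral_Ioc_main (a := H) (b := 0) (p := 1) one_pos hσ hX
  rw [zero_mul, add_zero] at h3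
  have hsub : Set.Ioc 0 X ⊆ Set.Ioi 0 := Set.Ioc_subset_Ioi_self
  rw [← h3, ← Set.inter_eq_self_of_subset_right hsub,
    ← setIntegral_indicator measurableSet_Ioc, ← integral_add h1
      ((h2.integrable_indicator measurableSet_Ioc).integrableOn)]
  refine setIntegral_congr_fun measurableSet_Ioi fun y _ => ?_
  by_cases hy : y ∈ Set.Ioc 0 X
  · simp only [Set.indicator_of_mem hy, removePole_of_mem hy]
    ring
  · simp only [Set.indicator_of_notMem hy, removePole, sub_zero, add_zero]

lemma le_integral_removePole_half {b : ℝ} (hf : ∀ y, 0 ≤ f y)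
    (hb : ∀ y, 0 < y → b * y ^ (-1 / 2 : ℝ) - 1 ≤ f y) {Y : ℝ} (hXY : X ≤ Y) :
    b * Real.log (Y / X) - 2 * √Y - 2 * h * √X ≤
      ∫ y in Set.Ioi 0, removePole f H X y * y ^ ((1 / 2 : ℝ) - 1) := by
  have hY : 0 < Y := hX.trans_le hXY
  have h_int := integrableOn_removePole hX hloc htop hlow hup (σ := 1 / 2) (by norm_num)
  have hI : ∀ Z : ℝ, 0 < Z →
      IntegrableOn (fun y : ℝ => y ^ ((1 / 2 : ℝ) - 1)) (Set.Ioc 0 Z) := fun Z hZ =>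
    integrableOn_Ioc_rpow (by norm_num) hZ
  have hIv : ∀ Z : ℝ, 0 < Z → ∫ y in Set.Ioc 0 Z, y ^ ((1 / 2 : ℝ) - 1) = 2 * √Z := fun Z hZ => by
    rw [setIntegral_Ioc_rpow (by norm_num) hZ, Real.sqrt_eq_rpow]
    norm_num
    ring
  have hsub : Set.Ioc X Y ⊆ Set.Ioi X := Set.Ioc_subset_Ioi_self
  have hsubX : Set.Ioi X ⊆ Set.Ioi 0 := Set.Ioi_subset_Ioi hX.le
  rw [← Set.Ioc_union_Ioi_eq_Ioi hX.le, setIntegral_union (Set.Ioc_disjoint_Ioi le_rfl)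
    measurableSet_Ioi (h_int.mono_set Set.Ioc_subset_Ioi_self) (h_int.mono_set hsubX)]
  have h1 : -(2 * h * √X) ≤
      ∫ y in Set.Ioc 0 X, removePole f H X y * y ^ ((1 / 2 : ℝ) - 1) := by
    have : -(2 * h * √X) = ∫ y in Set.Ioc 0 X, -h * y ^ ((1 / 2 : ℝ) - 1) := by
      rw [integral_const_mul, hIv X hX]; ring
    rw [this]
    refine setIntegral_mono_on ((hI X hX).const_mul _) (h_int.mono_set Set.Ioc_subset_Ioi_self)
      measurableSet_Ioc fun y hy =>
        mul_le_mul_of_nonneg_right ?_ (Real.rpow_nonneg hy.1.le _)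
    rw [removePole_of_mem hy]
    linarith [hlow y hy.1]
  have h2 : b * Real.log (Y / X) - 2 * √Y ≤
      ∫ y in Set.Ioi X, removePole f H X y * y ^ ((1 / 2 : ℝ) - 1) := by
    have hinv : IntegrableOn (fun y : ℝ => y⁻¹) (Set.Ioc X Y) := by
      refine ((continuousOn_inv₀.mono fun y hy => ?_).integrableOn_compact
        isCompact_Icc).mono_set Set.Ioc_subset_Icc_self
      exact (hX.trans_le hy.1).ne'
    have hXYs : Set.Ioc X Y ⊆ Set.Ioc 0 Y := Set.Ioc_subset_Ioc_left hX.le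
    have hIXY := (hI Y hY).mono_set hXYs
    have h3 : b * Real.log (Y / X) - 2 * √Y ≤
        ∫ y in Set.Ioc X Y, (b * y⁻¹ - y ^ ((1 / 2 : ℝ) - 1)) := by
      rw [integral_sub (hinv.const_mul b) hIXY, integral_const_mul,
        ← intervalIntegral.integral_of_le hXY, integral_inv_of_pos hX hY, ← hIv Y hY]
      refine sub_le_sub_left (setIntegral_mono_set (hI Y hY) ?_
        hXYs.eventuallyLE) _
      exact (ae_restrict_iff' measurableSet_Ioc).2 (ae_of_all _ fun y hy =>
        Real.rpow_nonneg hy.1.le _)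
    refine h3.trans ((setIntegral_mono_on ((hinv.const_mul b).sub hIXY)
      (h_int.mono_set (hsub.trans hsubX)) measurableSet_Ioc fun y hy => ?_).trans
      (setIntegral_mono_set (h_int.mono_set hsubX) ?_ hsub.eventuallyLE))
    · have hy0 : 0 < y := hX.trans hy.1
      have hyy : y ^ (-1 / 2 : ℝ) * y ^ ((1 / 2 : ℝ) - 1) = y⁻¹ := by
        rw [← Real.rpow_add hy0, ← Real.rpow_neg_one]; norm_num
      rw [removePole_of_lt hy.1]
      refine le_trans (b := (b * y ^ (-1 / 2 : ℝ) - 1) * y ^ ((1 / 2 : ℝ) - 1)) (le_of_eq ?_)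
        (mul_le_mul_of_nonneg_right (hb y hy0) (Real.rpow_nonneg hy0.le _))
      rw [sub_mul, mul_assoc, hyy, one_mul]
      rfl
    · refine (ae_restrict_iff' measurableSet_Ioi).2 (ae_of_all _ fun y (hy : X < y) => ?_)
      simp only [Pi.zero_apply, removePole_of_lt hy]
      exact mul_nonneg (hf y) (Real.rpow_nonneg (hX.trans hy).le _)
  linarith

/-- The analytic continuation of the Mellin transform of `f`, with a lower bound at `1 / 2`. -/
lemma exists_mellin_continuation {b : ℝ} (hf : ∀ y, 0 ≤ f y)
    (hb : ∀ y, 0 < y → b * y ^ (-1 / 2 : ℝ) - 1 ≤ f y) {Y : ℝ} (hXY : X ≤ Y) :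
    ∃ M : ℂ → ℂ, (∀ s, 0 < s.re → s ≠ 1 → DifferentiableAt ℂ M s) ∧
      (∀ s : ℝ, 1 < s → M s = ((∫ y in Set.Ioi 0, f y * y ^ (s - 1) : ℝ) : ℂ)) ∧
      b * Real.log (Y / X) - 2 * √Y - 2 * h * √X - 2 * H / √X ≤ (M (1 / 2)).re := by
  refine ⟨fun s => mellin (fun y => (removePole f H X y : ℂ)) s +
    H * ((X : ℂ) ^ (s - 1) / (s - 1)), fun s hs hs1 => ?_, fun s hs => ?_, ?_⟩
  · have hs1' : s - 1 ≠ 0 := sub_ne_zero.2 hs1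
    have hnum : DifferentiableAt ℂ (fun s : ℂ => (X : ℂ) ^ (s - 1)) s :=
      DifferentiableAt.const_cpow (by fun_prop) (Or.inl (by exact_mod_cast hX.ne'))
    have hden : DifferentiableAt ℂ (fun s : ℂ => s - 1) s := by fun_prop
    exact (differentiableAt_mellin_removePole hX hloc htop hlow hup hs).add
      ((hnum.div hden hs1').const_mul _)
  · simp only
    rw [mellin_ofReal, ← integral_removePole hX hloc htop hlow hup hs]
    push_cast [Complex.ofReal_cpow hX.le]
    rfl
  · have h1 := le_integral_removePole_half hX hloc htop hlow hup hf hb hXY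
    have h2 : ((1 / 2 : ℂ)) = ((1 / 2 : ℝ) : ℂ) := by norm_num
    have h3 : (X : ℂ) ^ (((1 / 2 : ℝ) : ℂ) - 1) / (((1 / 2 : ℝ) : ℂ) - 1) =
        ((-2 / √X : ℝ) : ℂ) := by
      rw [← Complex.ofReal_one, ← Complex.ofReal_sub, ← Complex.ofReal_cpow hX.le,
        ← Complex.ofReal_div, show (1 / 2 : ℝ) - 1 = -(1 / 2) by norm_num, Real.rpow_neg hX.le,
        ← Real.sqrt_eq_rpow]
      congr 1
      ring
    simp only
    rw [h2, mellin_ofReal, h3, ← Complex.ofReal_mul, ← Complex.ofReal_add, Complex.ofReal_re]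
    refine le_trans (le_of_eq ?_) (add_le_add h1 le_rfl)
    ring

end removePole

namespace PlaceTower
open NumberField.Units NumberField.InfinitePlace
variable {F K : Type} [Field F] [NumberField F] [Field K] [NumberField K] [Algebra F K]

lemma card_infinitePlace_of_isComplex (hF : ∀ v : InfinitePlace F, v.IsReal)
    (hK : ∀ w : InfinitePlace K, w.IsComplex) (hdeg : Module.finrank F K = 2) :
    Fintype.card (InfinitePlace K) = Fintype.card (InfinitePlace F) := by
  have h1 := sum_mult_eq (K := K)
  rw [Finset.sum_congr rfl fun w _ => mult_isComplex ⟨w, hK w⟩,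
    ← Module.finrank_mul_finrank ℚ F K, hdeg] at h1
  rw [card_infinitePlace_eq hF]
  simp at h1
  linarith

lemma bijective_comap (hF : ∀ v : InfinitePlace F, v.IsReal)
    (hK : ∀ w : InfinitePlace K, w.IsComplex) (hdeg : Module.finrank F K = 2) :
    Function.Bijective fun w : InfinitePlace K => w.comap (algebraMap F K) :=
  (Fintype.bijective_iff_surjective_and_card _).2
    ⟨comap_surjective, card_infinitePlace_of_isComplex hF hK hdeg⟩

/-- A CM extension, as a tower with corresponding infinite places. -/
noncomputable def ofCM (hF : ∀ v : InfinitePlace F, v.IsReal)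
    (hK : ∀ w : InfinitePlace K, w.IsComplex) (hdeg : Module.finrank F K = 2) :
    PlaceTower F K where
  e := (Equiv.ofBijective _ (bijective_comap hF hK hdeg)).symm
  m := 2
  e_apply v x := by
    rw [← comap_apply]
    exact congrArg (fun w : InfinitePlace F => w x)
      ((Equiv.ofBijective _ (bijective_comap hF hK hdeg)).apply_symm_apply v)
  mult_eq w := mult_isComplex ⟨w, hK w⟩
  isReal := hF

lemma gaussCoef_eq_of_isComplex
    (hK : ∀ w : InfinitePlace K, w.IsComplex) (hdeg : Module.finrank F K = 2) :
    gaussCoef K = 2 ^ Module.finrank ℚ F * (√((discr K).natAbs : ℝ))⁻¹ := by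
  have h0 : nrRealPlaces K = 0 := by
    classical
    rw [nrRealPlaces, Fintype.card_eq_zero_iff]
    exact ⟨fun v => not_isComplex_iff_isReal.2 v.2 (hK v.1)⟩
  have h1 := card_add_two_mul_card_eq_rank K
  rw [h0, zero_add, ← Module.finrank_mul_finrank ℚ F K, hdeg, mul_comm] at h1
  rw [gaussCoef, Nat.eq_of_mul_eq_mul_right two_pos h1, mul_inv, inv_pow, inv_inv,
    Nat.cast_natAbs, Int.cast_abs]

lemma zetaSeriesC_ofReal (s : ℝ) : zetaSeriesC K s = (zetaSeries K s : ℂ) := by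
  rw [zetaSeriesC, zetaSeries, Complex.ofReal_tsum]
  refine tsum_congr fun I => ?_
  rw [Complex.ofReal_cpow (Nat.cast_nonneg _)]
  push_cast
  rfl

/-- The gamma factor of a CM field with `2 * n` complex embeddings. -/
noncomputable def complexGammaFactor (n : ℕ) (s : ℂ) : ℂ :=
  ((Real.pi : ℂ) ^ (-s) * Complex.Gamma s) ^ n

lemma differentiableAt_complexGammaFactor (n : ℕ) {s : ℂ} (hs : 0 < s.re) :
    DifferentiableAt ℂ (complexGammaFactor n) s := by
  have h1 : DifferentiableAt ℂ (fun s : ℂ => (Real.pi : ℂ) ^ (-s)) s :=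
    DifferentiableAt.const_cpow (by fun_prop) (Or.inl (by exact_mod_cast Real.pi_ne_zero))
  have h2 : DifferentiableAt ℂ Complex.Gamma s := by
    refine Complex.differentiableAt_Gamma s fun m hm => ?_
    rw [hm] at hs
    simp at hs
    linarith [Nat.cast_nonneg (α := ℝ) m]
  exact (h1.mul h2).pow n

lemma complexGammaFactor_half (n : ℕ) : complexGammaFactor n (1 / 2) = 1 := by
  have h : (Real.pi : ℂ) ≠ 0 := by exact_mod_cast Real.pi_ne_zero
  rw [complexGammaFactor, Complex.Gamma_one_half_eq, ← Complex.cpow_add _ _ h]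
  norm_num

lemma complexGammaFactor_ofReal (n : ℕ) (s : ℝ) :
    complexGammaFactor n s = (((Real.pi ^ (-s) * Real.Gamma s) ^ n : ℝ) : ℂ) := by
  rw [complexGammaFactor, Complex.Gamma_ofReal]
  push_cast [Complex.ofReal_cpow Real.pi_pos.le]
  rfl

/-- The value at `1 / 2` of the completed Dedekind zeta function of `K` is bounded below in terms
of the Gauss sum coefficients of `F` and `K`. -/
lemma le_mul_zeta_half (hF : ∀ v : InfinitePlace F, v.IsReal)
    (hK : ∀ w : InfinitePlace K, w.IsComplex) (hdeg : Module.finrank F K = 2) {κ : ℝ}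
    {J : ClassGroup (𝓞 K) → (Ideal (𝓞 K))⁰} (hJ : J 1 = 1)
    (hκ : ∀ s : ℝ, 1 < s → ∫ y in Set.Ioi 0, (ofCM hF hK hdeg).theta J y * y ^ (s - 1) =
      κ * (Real.pi ^ (-s) * Real.Gamma s) ^ Module.finrank ℚ F * zetaSeries K s)
    {zetaK : ℂ → ℂ} (hz1 : ∀ s : ℂ, 1 < s.re → zetaK s = zetaSeriesC K s)
    (hz2 : ∀ s : ℂ, s ≠ 1 → DifferentiableAt ℂ zetaK s)
    (hle : gaussCoef K ≤ gaussCoef F ^ 2) :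
    gaussCoef F * Real.log (gaussCoef F ^ 2 / gaussCoef K) - 2 * gaussCoef F -
      4 * classNumber K * √(gaussCoef K) ≤ κ * (zetaK (1 / 2)).re := by
  have hT : ((ofCM hF hK hdeg).m : ℝ) = 2 := by simp [ofCM]
  have haK := gaussCoef_pos K
  obtain ⟨C, -, hC⟩ := (ofCM hF hK hdeg).exists_theta_le J
  obtain ⟨M, hM1, hM2, hM3⟩ := exists_mellin_continuation (f := (ofCM hF hK hdeg).theta J)
    (H := classNumber K * gaussCoef K) (h := classNumber K) (C := C) (b := gaussCoef F)
    haK ((ofCM hF hK hdeg).locallyIntegrableOn_theta J)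
    (fun A => (ofCM hF hK hdeg).theta_isBigO_atTop J A)
    (fun y hy => by
      have := (ofCM hF hK hdeg).sub_le_theta J hy
      rw [hT, neg_div, div_self two_ne_zero] at this
      linarith)
    (fun y hy => by
      have := hC y hy
      rw [hT, neg_div, div_self two_ne_zero] at this
      linarith)
    ((ofCM hF hK hdeg).theta_nonneg J)
    (fun y hy => (ofCM hF hK hdeg).sub_one_le_theta hJ hy) hle
  have hMN := eq_at_half_of_eq_real (M := M)
    (N := fun s => κ * complexGammaFactor (Module.finrank ℚ F) s * zetaK s) hM1
    (fun s hs hs1 => ((differentiableAt_complexGammaFactor _ hs).const_mul _).mul (hz2 s hs1))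
    (fun s hs => by
      rw [hM2 s hs, hκ s hs, complexGammaFactor_ofReal, hz1 s (by simpa using hs),
        zetaSeriesC_ofReal]
      push_cast
      rfl)
  rw [hMN] at hM3
  simp only [complexGammaFactor_half, mul_one, Complex.re_ofReal_mul] at hM3
  refine le_trans (le_of_eq ?_) hM3
  rw [Real.sqrt_sq (gaussCoef_pos F).le, mul_div_assoc (2 : ℝ), mul_div_assoc,
    Real.div_sqrt]
  ring

end PlaceTower

/-- The final estimate, in terms of `d = D_F`, `D = D_K` and `L = log (√D / d)`. -/
lemma mul_le_of_theta_bound {n : ℕ} (hn : 1 ≤ n) {d D γ h L : ℝ} (hd : 1 ≤ d) (hD : 1 ≤ D)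
    (hh : 1 ≤ h) (hL : L = Real.log (√D / d))
    (hγ : Real.log (√d)⁻¹ + n - 1 ≤ γ)
    (hkey : 2 ^ n * (√D)⁻¹ ≤ (√d)⁻¹ ^ 2 →
      (√d)⁻¹ * Real.log ((√d)⁻¹ ^ 2 / (2 ^ n * (√D)⁻¹)) - 2 * (√d)⁻¹ -
        4 * h * √(2 ^ n * (√D)⁻¹) ≤ (√d)⁻¹ * L / 2) :
    D ^ (1 / 4 : ℝ) * L ≤ h * (Real.exp (2 * γ + 2 * n + 2) *
      (4 * γ + 3 * Real.log d + 4 * n + √(7 * n) + 8) * d ^ (3 / 2 : ℝ)) := by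
  have hn' : (1 : ℝ) ≤ n := by exact_mod_cast hn
  have hd0 : 0 < d := by linarith
  have hD0 : 0 < D := by linarith
  have hb : 0 < √d := Real.sqrt_pos.2 hd0
  have hsD : 0 < √D := Real.sqrt_pos.2 hD0
  have hbb : √d * √d = d := Real.mul_self_sqrt hd0.le
  have hlogd : 0 ≤ Real.log d := Real.log_nonneg hd
  rw [Real.log_inv, Real.log_sqrt hd0.le] at hγ
  have hexpL : √D = d * Real.exp L := by
    rw [hL, Real.exp_log (by positivity)]; field_simp
  have hR : D ^ (1 / 4 : ℝ) = √d * Real.exp (L / 2) := by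
    rw [show (1 / 4 : ℝ) = 1 / 2 * (1 / 2) by norm_num, Real.rpow_mul hD0.le,
      ← Real.sqrt_eq_rpow, ← Real.sqrt_eq_rpow, hexpL, Real.sqrt_mul hd0.le, Real.exp_half]
  have hd32 : d ^ (3 / 2 : ℝ) = d * √d := by
    rw [show (3 / 2 : ℝ) = 1 + 1 / 2 by norm_num, Real.rpow_add hd0, Real.rpow_one,
      Real.sqrt_eq_rpow]
  have hE : Real.exp (2 * γ + 2 * n + 2) * d = Real.exp (2 * γ + 2 * n + 2 + Real.log d) := by
    rw [Real.exp_add _ (Real.log d), Real.exp_log hd0]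
  have hs7 := Real.sqrt_nonneg (7 * (n : ℝ))
  set Υ := 4 * γ + 3 * Real.log d + 4 * n + √(7 * n) + 8 with hΥ
  have hΥ12 : 12 ≤ Υ := by linarith
  have hrhs : h * (Real.exp (2 * γ + 2 * n + 2) * Υ * d ^ (3 / 2 : ℝ)) =
      √d * (h * Υ * Real.exp (2 * γ + 2 * n + 2 + Real.log d)) := by
    rw [hd32, ← hE]; ring
  rw [hrhs, hR, mul_assoc]
  refine mul_le_mul_of_nonneg_left ?_ hb.le
  rcases le_or_gt L (4 * γ + 2 * Real.log d + 4 * n + 4) with hLT | hLT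
  · rcases le_or_gt L 0 with hL0 | hL0
    · exact (mul_nonpos_of_nonneg_of_nonpos (Real.exp_pos _).le hL0).trans (by positivity)
    · have h1 : L ≤ h * Υ := by nlinarith
      rw [mul_comm]
      exact mul_le_mul h1 (Real.exp_le_exp.2 (by linarith)) (Real.exp_pos _).le (by positivity)
  · have hlog2 := Real.log_two_lt_d9
    have hlog2' := Real.log_two_gt_d9
    have h8 : 8 * (n : ℝ) ≤ L := by linarith
    have haK : 2 ^ n * (√D)⁻¹ = Real.exp (n * Real.log 2 - L) * (√d)⁻¹ ^ 2 := by
      rw [hexpL, Real.exp_sub, mul_comm (n : ℝ), Real.exp_mul, Real.exp_log two_pos,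
        Real.rpow_natCast, inv_pow, Real.sq_sqrt hd0.le]
      field_simp
    have hnl : n * Real.log 2 ≤ 0.7 * n := by nlinarith
    rw [haK] at hkey
    have hle : Real.exp (n * Real.log 2 - L) ≤ 1 := Real.exp_le_one_iff.2 (by linarith)
    have hb2 : 0 < (√d)⁻¹ ^ 2 := by positivity
    have h2 := hkey (mul_le_of_le_one_left hb2.le hle)
    rw [Real.sqrt_mul (Real.exp_pos _).le, Real.sqrt_sq (by positivity), mul_comm (Real.exp _),
      ← div_div, div_self hb2.ne', one_div, Real.log_inv, Real.log_exp, ← Real.exp_half] at h2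
    have hbi : 0 < (√d)⁻¹ := by positivity
    have h3 : (L - n * Real.log 2) - 2 - 4 * h * Real.exp ((n * Real.log 2 - L) / 2) ≤ L / 2 := by
      refine le_of_mul_le_mul_left ?_ hbi
      linarith
    have h4 : 0.04 * L ≤ h * Real.exp ((n * Real.log 2 - L) / 2) := by linarith
    have h5 : Real.exp (L / 2) * Real.exp ((n * Real.log 2 - L) / 2) =
        Real.exp (n * Real.log 2 / 2) := by
      rw [← Real.exp_add]; congr 1; ring
    have h6 : 0.04 * (Real.exp (L / 2) * L) ≤ h * Real.exp (n * Real.log 2 / 2) := by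
      rw [← h5]
      nlinarith [mul_le_mul_of_nonneg_left h4 (Real.exp_pos (L / 2)).le]
    have h7 : 3 * Real.exp (n * Real.log 2 / 2) ≤ Real.exp (2 * γ + 2 * n + 2 + Real.log d) := by
      have h8 : (3 : ℝ) ≤ Real.exp 2 := by
        have := Real.add_one_le_exp (2 : ℝ); linarith
      calc _ ≤ Real.exp 2 * Real.exp (n * Real.log 2 / 2) := by gcongr
        _ ≤ _ := by rw [← Real.exp_add]; exact Real.exp_le_exp.2 (by linarith)
    have h9 : h * 12 * (3 * Real.exp (n * Real.log 2 / 2)) ≤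
        h * Υ * Real.exp (2 * γ + 2 * n + 2 + Real.log d) := by gcongr
    have h10 : 0 ≤ h * Real.exp (n * Real.log 2 / 2) := by positivity
    linarith

/-- if `ζ_K(1/2) ≤ ρ_F/(4[𝓞_K^×:𝓞_F^×]h_F) · log(√D_K/D_F)` for a CM extension
`K/F`, then `h_K ≥ Ψ_F⁻¹ D_K^{1/4} log(√D_K/D_F)`. -/
theorem stmt0
    (F K : Type) [Field F] [NumberField F] [Field K] [NumberField K] [Algebra F K]
    -- `F` is totally real of degree `n`, and `K/F` is a CM extension:
    (hFreal : ∀ v : InfinitePlace F, v.IsReal)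
    (hKcm : ∀ w : InfinitePlace K, w.IsComplex)
    (hdeg : Module.finrank F K = 2)
    -- `ρ_F` is the residue at `s = 1` of `ζ_F` and `γ_F^*` is the normalized
    -- Euler-Kronecker constant:
    (ρF γF : ℝ)
    (hρ : Tendsto (fun s : ℝ => (s - 1) * zetaSeries F s) (𝓝[>] 1) (𝓝 ρF))
    (hγ : Tendsto (fun s : ℝ => ρF⁻¹ * zetaSeries F s - 1 / (s - 1)) (𝓝[>] 1) (𝓝 γF))
    -- `zetaK` is the analytic continuation of the Dedekind zeta function of `K`:
    (zetaK : ℂ → ℂ)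
    (hzK1 : ∀ s : ℂ, 1 < s.re → zetaK s = zetaSeriesC K s)
    (hzK2 : ∀ s : ℂ, s ≠ 1 → DifferentiableAt ℂ zetaK s)
    -- the assumption `ζ_K(1/2) ≤ ρ_F/(4[𝓞_K^×:𝓞_F^×]h_F) · log(√D_K/D_F)`:
    (hassump : zetaK (1 / 2) ≤
      ((ρF / (4 * (unitIndex F K : ℝ) * (classNumber F : ℝ)) *
        Real.log (Real.sqrt ((discr K).natAbs) / ((discr F).natAbs : ℝ)) : ℝ) : ℂ)) :
    (classNumber K : ℝ) ≥
      (Real.pi ^ (-(Module.finrank ℚ F : ℝ)) * ρF⁻¹ * (classNumber F : ℝ) *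
          ((discr F).natAbs : ℝ) ^ (2 : ℕ)
        + Real.exp (2 * γF + 2 * (Module.finrank ℚ F : ℝ) + 2) *
          (4 * γF + 3 * Real.log ((discr F).natAbs : ℝ) + 4 * (Module.finrank ℚ F : ℝ)
            + Real.sqrt (7 * (Module.finrank ℚ F : ℝ)) + 8) *
          ((discr F).natAbs : ℝ) ^ ((3 : ℝ) / 2))⁻¹ *
      ((discr K).natAbs : ℝ) ^ ((1 : ℝ) / 4) *
      Real.log (Real.sqrt ((discr K).natAbs) / ((discr F).natAbs : ℝ)) := by
  obtain ⟨κ, hκ0, hκ⟩ := PlaceTower.exists_integral_theta F hFreal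
  obtain ⟨JF, hJF, -⟩ := PlaceTower.exists_class_representatives F
  obtain ⟨JK, hJK, hJK1⟩ := PlaceTower.exists_class_representatives K
  have hcard := PlaceTower.card_infinitePlace_eq hFreal
  have hκF : ∀ s, 1 < s →
      ∫ y in Set.Ioi 0, (PlaceTower.refl F hFreal).theta JF y * y ^ (s / 2 - 1) =
        κ * (Real.pi ^ (-(s / 2)) * Real.Gamma (s / 2)) ^ Module.finrank ℚ F *
          zetaSeries F s := fun s hs => by
    have h := (hκ (PlaceTower.refl F hFreal) hJF hs).2.2
    simpa only [PlaceTower.index_range_unitsMap_self, PlaceTower.gammaFactor, hcard,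
      PlaceTower.refl, Nat.cast_one, one_mul, zetaSeries] using h
  have hq0 : unitIndex F K ≠ 0 :=
    (hκ (PlaceTower.ofCM hFreal hKcm hdeg) hJK (one_lt_two (α := ℝ))).1
  have hκK : ∀ s, 1 < s →
      ∫ y in Set.Ioi 0, (PlaceTower.ofCM hFreal hKcm hdeg).theta JK y * y ^ (s - 1) =
        unitIndex F K * κ * (Real.pi ^ (-s) * Real.Gamma s) ^ Module.finrank ℚ F *
          zetaSeries K s := fun s hs => by
    have h := (hκ (PlaceTower.ofCM hFreal hKcm hdeg) hJK hs).2.2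
    simp only [PlaceTower.gammaFactor, hcard, PlaceTower.ofCM, Nat.cast_ofNat,
      mul_div_cancel_left₀ _ (two_ne_zero (α := ℝ))] at h
    rw [mul_assoc, mul_assoc, ← mul_assoc κ]
    exact h
  have hres := PlaceTower.mul_residue_eq hFreal hκF hρ
  have hγ' := PlaceTower.le_eulerKronecker hFreal hκF hκ0 hρ hγ
  have hkey := PlaceTower.le_mul_zeta_half hFreal hKcm hdeg hJK1 hκK hzK1 hzK2
  have haF := PlaceTower.gaussCoef_pos F
  have hhF : (0 : ℝ) < classNumber F := by exact_mod_cast Fintype.card_pos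
  have hhK : (1 : ℝ) ≤ classNumber K := by exact_mod_cast Fintype.card_pos
  have hρ0 : 0 < ρF := pos_of_mul_pos_right (by rw [hres]; positivity) hκ0.le
  have hdF : (1 : ℝ) ≤ (discr F).natAbs := by
    exact_mod_cast Int.natAbs_pos.2 (discr_ne_zero F)
  have hdK : (1 : ℝ) ≤ (discr K).natAbs := by
    exact_mod_cast Int.natAbs_pos.2 (discr_ne_zero K)
  have hq : (0 : ℝ) < unitIndex F K := by exact_mod_cast Nat.pos_of_ne_zero hq0
  have hre := (Complex.le_def.1 hassump).1
  rw [Complex.ofReal_re] at hre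
  set L := Real.log (√((discr K).natAbs : ℝ) / ((discr F).natAbs : ℝ)) with hL
  have hup : unitIndex F K * κ * (zetaK (1 / 2)).re ≤ PlaceTower.gaussCoef F * L / 2 := by
    refine (mul_le_mul_of_nonneg_left hre (mul_pos hq hκ0).le).trans (le_of_eq ?_)
    calc _ = κ * ρF * L / (4 * classNumber F) := by field_simp
      _ = _ := by rw [hres]; field_simp; ring
  rw [PlaceTower.gaussCoef_eq_of_isReal hFreal] at hγ' hkey hup
  rw [PlaceTower.gaussCoef_eq_of_isComplex hKcm hdeg] at hkey
  have hfin := mul_le_of_theta_bound Module.finrank_pos hdF hdK hhK hL hγ'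
    fun h => (hkey h).trans hup
  have hlog := Real.log_nonneg hdF
  have hn : (1 : ℝ) ≤ Module.finrank ℚ F := by
    exact_mod_cast Module.finrank_pos (R := ℚ) (M := F)
  rw [Real.log_inv, Real.log_sqrt (by linarith)] at hγ'
  have hs7 := Real.sqrt_nonneg (7 * (Module.finrank ℚ F : ℝ))
  have hΥ : 0 < 4 * γF + 3 * Real.log ((discr F).natAbs : ℝ) + 4 * (Module.finrank ℚ F : ℝ)
      + √(7 * (Module.finrank ℚ F : ℝ)) + 8 := by linarith
  have hd0 : (0 : ℝ) < (discr F).natAbs := by linarith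
  have hc : 0 ≤ Real.pi ^ (-(Module.finrank ℚ F : ℝ)) * ρF⁻¹ * (classNumber F : ℝ) *
      ((discr F).natAbs : ℝ) ^ (2 : ℕ) := by positivity
  rw [ge_iff_le, mul_assoc, inv_mul_le_iff₀ (add_pos_of_nonneg_of_pos hc (by positivity))]
  refine hfin.trans ?_
  rw [mul_comm]
  gcongr
  exact le_add_of_nonneg_left hc
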